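/- arXiv:1101.1946 — 5 statements merged into one kernel-verified Lean document; each statement's English description precedes it below -/
import Mathlib

section
/- For n = 0, 1, 2, … define a_n = ∑_{k=0}^n C(n,k)² C_k, where C_k = C(2k,k)/(k+1) is the k-th Catalan number. Then for any odd prime p we have a_1 + a_2 + ⋯ + a_{p-1} ≡ 0 (mod p²). -/
/-- `a_n = ∑_{k=0}^n C(n,k)² C_k`, with `C_k` the `k`-th Catalan number. -/
def aSeq (n : ℕ) : ℤ :=
  ∑ k ∈ Finset.range (n + 1), (n.choose k : ℤ) ^ 2 * (catalan k : ℤ)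

/-- `∑_{n < N} C(n,k)²`. -/
def sumChooseSq (N k : ℕ) : ℤ :=
  ∑ n ∈ Finset.range N, (n.choose k : ℤ) ^ 2

theorem sumChooseSq_rec (N k : ℕ) :
    2 * (2 * (k : ℤ) + 3) * sumChooseSq N (k + 1) - (k + 1) * sumChooseSq N k =
      (2 * N - 3 * (k + 1)) * (N.choose (k + 1) : ℤ) ^ 2 := by
  induction N with
  | zero => simp [sumChooseSq]
  | succ n ih =>
    have h : (n.choose (k + 1) : ℤ) * (k + 1) = n.choose k * (n - k) := by
      rcases le_or_gt k n with hk | hk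
      · have := Nat.choose_succ_right_eq n k
        zify [hk] at this
        exact this
      · simp [Nat.choose_eq_zero_of_lt hk, Nat.choose_eq_zero_of_lt (Nat.lt_succ_of_lt hk)]
    simp only [sumChooseSq, Finset.sum_range_succ, Nat.choose_succ_succ' n k] at ih ⊢
    push_cast
    linear_combination ih + (2 * (n.choose k : ℤ) + 4 * n.choose (k + 1)) * h

/-- The product `(2k+1) C(2k,k) ∑_{n < N} C(n,k)²`, which is nearly constant in `k`. -/
def weightedSum (N k : ℕ) : ℤ :=
  (2 * k + 1) * (k.centralBinom : ℤ) * sumChooseSq N k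

theorem weightedSum_succ_sub (N k : ℕ) :
    2 * (weightedSum N (k + 1) - weightedSum N k) =
      ((k + 1).centralBinom : ℤ) * (2 * N - 3 * (k + 1)) * (N.choose (k + 1) : ℤ) ^ 2 := by
  have h : ((k : ℤ) + 1) * ((k + 1).centralBinom : ℤ) =
      2 * (2 * k + 1) * (k.centralBinom : ℤ) := by
    exact_mod_cast Nat.succ_mul_centralBinom_succ k
  simp only [weightedSum]
  push_cast
  linear_combination ((k + 1).centralBinom : ℤ) * sumChooseSq_rec N k +
    sumChooseSq N k * h

theorem weightedSum_eq_catalan (N k : ℕ) :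
    weightedSum N k = (k + 1) * (2 * k + 1) * ((catalan k : ℤ) * sumChooseSq N k) := by
  have h : ((k : ℤ) + 1) * (catalan k : ℤ) = k.centralBinom := by
    exact_mod_cast succ_mul_catalan_eq_centralBinom k
  rw [weightedSum, ← h]
  ring

theorem weightedSum_zero (N : ℕ) : weightedSum N 0 = N := by
  simp [weightedSum, sumChooseSq]

theorem sumChooseSq_succ_self (n : ℕ) : sumChooseSq (n + 1) n = 1 := by
  rw [sumChooseSq, Finset.sum_range_succ, Finset.sum_eq_zero]
  · simp
  · intro i hi
    simp [Nat.choose_eq_zero_of_lt (Finset.mem_range.mp hi)]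

section Prime

variable {p : ℕ}

theorem dvd_of_dvd_two_mul (hp : p.Prime) (hp2 : p ≠ 2) {n : ℕ} {a : ℤ}
    (h : (p : ℤ) ^ n ∣ 2 * a) : (p : ℤ) ^ n ∣ a := by
  refine IsCoprime.dvd_of_dvd_mul_left ?_ h
  apply IsCoprime.pow_left
  have : Nat.Coprime p 2 := (Nat.coprime_primes hp Nat.prime_two).2 hp2
  exact_mod_cast Nat.isCoprime_iff_coprime.2 this

theorem sq_dvd_choose_sq (hp : p.Prime) {k : ℕ} (hk0 : k ≠ 0) (hk : k < p) :
    (p : ℤ) ^ 2 ∣ (p.choose k : ℤ) ^ 2 :=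
  pow_dvd_pow_of_dvd (Int.natCast_dvd_natCast.2 (hp.dvd_choose_self hk0 hk)) 2

theorem sq_dvd_weightedSum_sub (hp : p.Prime) (hp2 : p ≠ 2) {k : ℕ} (hk : k < p) :
    (p : ℤ) ^ 2 ∣ weightedSum p k - p := by
  induction k with
  | zero => simp [weightedSum_zero]
  | succ k ih =>
    have h : (p : ℤ) ^ 2 ∣ weightedSum p (k + 1) - weightedSum p k := by
      apply dvd_of_dvd_two_mul hp hp2
      rw [weightedSum_succ_sub]
      exact Dvd.dvd.mul_left (sq_dvd_choose_sq hp k.succ_ne_zero hk) _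
    simpa using dvd_add h (ih (by omega))

theorem dvd_centralBinom (hp : p.Prime) {k : ℕ} (hk : k < p) (hk2 : p ≤ 2 * k) :
    (p : ℤ) ∣ (k.centralBinom : ℤ) := by
  rw [Int.natCast_dvd_natCast, Nat.centralBinom]
  exact hp.dvd_choose hk (by omega) hk2

theorem cube_dvd_weightedSum_sub_of_le (hp : p.Prime) (hp2 : p ≠ 2) {m k : ℕ}
    (hm : p ≤ 2 * m + 1) (hmk : m ≤ k) (hk : k < p) :
    (p : ℤ) ^ 3 ∣ weightedSum p k - weightedSum p m := by
  induction k, hmk using Nat.le_induction with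
  | base => simp
  | succ k hmk ih =>
    have h : (p : ℤ) ^ 3 ∣ weightedSum p (k + 1) - weightedSum p k := by
      apply dvd_of_dvd_two_mul hp hp2
      rw [weightedSum_succ_sub, pow_succ']
      exact mul_dvd_mul (Dvd.dvd.mul_right (dvd_centralBinom hp hk (by omega)) _)
        (sq_dvd_choose_sq hp k.succ_ne_zero hk)
    simpa using dvd_add h (ih (by omega))

theorem sq_dvd_centralBinom_sub_two (hp : p.Prime) :
    (p : ℤ) ^ 2 ∣ (p.centralBinom : ℤ) - 2 := by
  have h : (p.centralBinom : ℤ) = ∑ i ∈ Finset.range (p + 1), (p.choose i : ℤ) ^ 2 := by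
    rw [Nat.centralBinom]
    exact_mod_cast (Nat.sum_range_choose_sq p).symm
  obtain ⟨q, rfl⟩ : ∃ q, p = q + 1 := ⟨p - 1, by have := hp.pos; omega⟩
  rw [h, Finset.sum_range_succ, Finset.sum_range_succ']
  have : ((q + 1 : ℕ) : ℤ) ^ 2 ∣
      ∑ i ∈ Finset.range q, ((q + 1).choose (i + 1) : ℤ) ^ 2 :=
    Finset.dvd_sum fun i hi => sq_dvd_choose_sq hp i.succ_ne_zero
      (by have := Finset.mem_range.mp hi; omega)
  simpa [add_sub_assoc, show (1 : ℤ) + (1 - 2) = 0 by norm_num] using this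

theorem cube_dvd_weightedSum_pred_sub (hp : p.Prime) (hp2 : p ≠ 2) :
    (p : ℤ) ^ 3 ∣ weightedSum p (p - 1) - p := by
  apply dvd_of_dvd_two_mul hp hp2
  have h := sq_dvd_centralBinom_sub_two hp
  obtain ⟨q, rfl⟩ : ∃ q, p = q + 1 := ⟨p - 1, by have := hp.pos; omega⟩
  have h2 : ((q : ℤ) + 1) * ((q + 1).centralBinom : ℤ) =
      2 * (2 * q + 1) * (q.centralBinom : ℤ) := by
    exact_mod_cast Nat.succ_mul_centralBinom_succ q
  rw [Nat.add_sub_cancel, weightedSum, sumChooseSq_succ_self, pow_succ']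
  have h3 : 2 * ((2 * (q : ℤ) + 1) * (q.centralBinom : ℤ) * 1 - ((q + 1 : ℕ) : ℤ)) =
      ((q + 1 : ℕ) : ℤ) * (((q + 1).centralBinom : ℤ) - 2) := by
    push_cast
    linear_combination -h2
  rw [h3]
  exact mul_dvd_mul_left _ h

theorem cube_dvd_weightedSum_half_sub (hp : p.Prime) (hp2 : p ≠ 2) {m : ℕ}
    (hm : p = 2 * m + 1) : (p : ℤ) ^ 3 ∣ weightedSum p m - p := by
  have h1 := cube_dvd_weightedSum_sub_of_le hp hp2 (m := m) (k := p - 1)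
    (by omega) (by omega) (by omega)
  have h2 := cube_dvd_weightedSum_pred_sub hp hp2
  simpa using dvd_sub h2 h1

theorem sum_zmod_eq_sum_range [NeZero p] (f : ZMod p → ZMod p) :
    ∑ k ∈ Finset.range p, f (k : ZMod p) = ∑ x, f x := by
  refine Finset.sum_bij (fun k _ => (k : ZMod p)) (by simp) ?_ ?_ (by simp)
  · intro a ha b hb h
    have := (ZMod.natCast_eq_natCast_iff' a b p).1 h
    rwa [Nat.mod_eq_of_lt (Finset.mem_range.1 ha),
      Nat.mod_eq_of_lt (Finset.mem_range.1 hb)] at this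
  · intro x _
    exact ⟨x.val, Finset.mem_range.2 x.val_lt, by simp⟩

theorem sum_inv_sub_inv_eq_zero [Fact p.Prime] (hp2 : p ≠ 2) :
    ∑ x : ZMod p, (2 * (2 * x + 1)⁻¹ - (x + 1)⁻¹) = 0 := by
  have two_ne : (2 : ZMod p) ≠ 0 := by
    have : Fact (2 < p) := ⟨lt_of_le_of_ne (Fact.out : p.Prime).two_le hp2.symm⟩
    exact (ZMod.neg_one_ne_one (n := p)).elim ∘ fun h => by linear_combination -h
  have key : ∑ x : ZMod p, x⁻¹ = 0 := by
    have h : ∑ x : ZMod p, x⁻¹ = ∑ x : ZMod p, (-x)⁻¹ :=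
      (Equiv.sum_comp (Equiv.neg (ZMod p)) fun x => x⁻¹).symm
    simp only [inv_neg, Finset.sum_neg_distrib] at h
    have h' : 2 * ∑ x : ZMod p, x⁻¹ = 0 := by linear_combination h
    exact (mul_eq_zero.1 h').resolve_left two_ne
  have h1 : ∑ x : ZMod p, (x + 1)⁻¹ = 0 :=
    (Equiv.sum_comp (Equiv.addRight (1 : ZMod p)) fun x => x⁻¹).trans key
  have h2 : ∑ x : ZMod p, (2 * x + 1)⁻¹ = 0 :=
    (Equiv.sum_comp ((Equiv.mulLeft₀ (2 : ZMod p) two_ne).trans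
      (Equiv.addRight (1 : ZMod p))) fun x => x⁻¹).trans key
  rw [Finset.sum_sub_distrib, ← Finset.mul_sum, h1, h2]
  ring

theorem exists_catalan_mul_sumChooseSq_eq (hp : p.Prime) (hp2 : p ≠ 2) {k : ℕ}
    (hk : k + 1 < p) (hk2 : p ≠ 2 * k + 1) :
    ∃ y : ℤ, (catalan k : ℤ) * sumChooseSq p k = p * y ∧
      (y : ZMod p) = 2 * (2 * (k : ZMod p) + 1)⁻¹ - ((k : ZMod p) + 1)⁻¹ := by
  have : Fact p.Prime := ⟨hp⟩
  obtain ⟨c, hc⟩ := sq_dvd_weightedSum_sub hp hp2 (k := k) (by omega)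
  rw [weightedSum_eq_catalan] at hc
  have hp0 : (p : ℤ) ≠ 0 := by exact_mod_cast hp.ne_zero
  have hprime : Prime (p : ℤ) := Nat.prime_iff_prime_int.1 hp
  have ha : ¬ p ∣ k + 1 := Nat.not_dvd_of_pos_of_lt (by omega) hk
  have hb : ¬ p ∣ 2 * k + 1 := by
    rintro ⟨d, hd⟩
    rcases d with _ | _ | d
    · omega
    · omega
    · nlinarith
  have hd : (p : ℤ) ∣ ((k : ℤ) + 1) * (2 * k + 1) * ((catalan k : ℤ) * sumChooseSq p k) :=
    ⟨1 + p * c, by linear_combination hc⟩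
  have hab : ¬ (p : ℤ) ∣ ((k : ℤ) + 1) * (2 * k + 1) := by
    intro h
    rcases hprime.dvd_or_dvd h with h | h
    · exact ha (by exact_mod_cast h)
    · exact hb (by exact_mod_cast h)
  obtain ⟨y, hy⟩ := (hprime.dvd_or_dvd hd).resolve_left hab
  refine ⟨y, hy, ?_⟩
  have h1 : ((k : ℤ) + 1) * (2 * k + 1) * y = 1 + p * c := by
    apply mul_left_cancel₀ hp0
    rw [hy] at hc
    linear_combination hc
  have h2 : ((k : ZMod p) + 1) * (2 * k + 1) * (y : ZMod p) = 1 := by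
    have := congrArg (Int.cast : ℤ → ZMod p) h1
    push_cast at this
    simpa using this
  have ha' : (k : ZMod p) + 1 ≠ 0 := by
    intro h
    rw [h] at h2
    simp at h2
  have hb' : 2 * (k : ZMod p) + 1 ≠ 0 := by
    intro h
    rw [h] at h2
    simp at h2
  field_simp
  linear_combination h2

end Prime

theorem sum_aSeq_range (N : ℕ) :
    ∑ n ∈ Finset.range N, aSeq n =
      ∑ k ∈ Finset.range N, (catalan k : ℤ) * sumChooseSq N k := by
  have h : ∀ n ∈ Finset.range N, aSeq n =
      ∑ k ∈ Finset.range N, (n.choose k : ℤ) ^ 2 * (catalan k : ℤ) := by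
    intro n hn
    refine Finset.sum_subset (Finset.range_subset_range.2 (Finset.mem_range.1 hn)) ?_
    intro k _ hk
    simp [Nat.choose_eq_zero_of_lt (show n < k by simpa using hk)]
  rw [Finset.sum_congr rfl h, Finset.sum_comm]
  refine Finset.sum_congr rfl fun k _ => ?_
  rw [sumChooseSq, Finset.mul_sum]
  exact Finset.sum_congr rfl fun n _ => mul_comm _ _

/-- For any odd prime `p`, `a_1 + a_2 + ⋯ + a_{p-1} ≡ 0 (mod p²)`. -/
theorem sum_aSeq_mod_p_sq (p : ℕ) (hp : p.Prime) (hp2 : p ≠ 2) :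
    (p : ℤ) ^ 2 ∣ ∑ n ∈ Finset.Icc 1 (p - 1), aSeq n := by
  have : Fact p.Prime := ⟨hp⟩
  obtain ⟨m, hm⟩ := hp.odd_of_ne_two hp2
  have hm0 : 0 < m := by have := hp.two_le; omega
  have hp0 : (p : ℤ) ≠ 0 := by exact_mod_cast hp.ne_zero
  have hsum : ∑ n ∈ Finset.Icc 1 (p - 1), aSeq n =
      (∑ k ∈ Finset.range p, (catalan k : ℤ) * sumChooseSq p k) - 1 := by
    rw [← sum_aSeq_range, Finset.range_eq_Ico,
      Finset.sum_eq_sum_Ico_succ_bot hp.pos]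
    have : Finset.Icc 1 (p - 1) = Finset.Ico (0 + 1) p := by
      ext; simp; omega
    rw [this]
    simp [aSeq]
  have split : ∀ {M : Type} [AddCommGroup M] (f : ℕ → M), ∑ k ∈ Finset.range p, f k =
      f m + (f (p - 1) + ∑ k ∈ ((Finset.range p).erase m).erase (p - 1), f k) := by
    intro M _ f
    rw [Finset.add_sum_erase _ f (by simp; omega), Finset.add_sum_erase _ f (by simp; omega)]
  have hy : ∀ k : ℕ, ∃ y : ℤ, k ∈ ((Finset.range p).erase m).erase (p - 1) →
      (catalan k : ℤ) * sumChooseSq p k = p * y ∧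
        (y : ZMod p) = 2 * (2 * (k : ZMod p) + 1)⁻¹ - ((k : ZMod p) + 1)⁻¹ := by
    intro k
    by_cases hk : k ∈ ((Finset.range p).erase m).erase (p - 1)
    · simp only [Finset.mem_erase, Finset.mem_range] at hk
      obtain ⟨y, hy⟩ := exists_catalan_mul_sumChooseSq_eq hp hp2 (k := k)
        (by omega) (by omega)
      exact ⟨y, fun _ => hy⟩
    · exact ⟨0, fun h => absurd h hk⟩
  choose y hy using hy
  obtain ⟨c, hc⟩ : (p : ℤ) ∣ (∑ k ∈ ((Finset.range p).erase m).erase (p - 1), y k) - 4 := by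
    rw [← ZMod.intCast_zmod_eq_zero_iff_dvd]
    push_cast
    rw [Finset.sum_congr rfl fun k hk => (hy k hk).2]
    have h0 := (sum_zmod_eq_sum_range _).trans (sum_inv_sub_inv_eq_zero hp2)
    rw [split] at h0
    have hmz : 2 * (m : ZMod p) + 1 = 0 := by
      have h := congrArg (Nat.cast : ℕ → ZMod p) hm
      rw [ZMod.natCast_self] at h
      push_cast at h
      exact h.symm
    have hm1 : ((m : ZMod p) + 1)⁻¹ = 2 :=
      inv_eq_of_mul_eq_one_right (by linear_combination hmz)
    have hpz : ((p - 1 : ℕ) : ZMod p) = -1 := by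
      rw [Nat.cast_sub hp.one_le]; simp
    have hneg : (2 * (-1 : ZMod p) + 1)⁻¹ = -1 :=
      inv_eq_of_mul_eq_one_right (by ring)
    rw [hmz, hm1, hpz, hneg, neg_add_cancel, inv_zero] at h0
    linear_combination h0
  obtain ⟨a, ha⟩ := cube_dvd_weightedSum_half_sub hp hp2 hm
  obtain ⟨b, hb⟩ := cube_dvd_weightedSum_pred_sub hp hp2
  rw [weightedSum_eq_catalan] at ha hb
  rw [hsum, split, Finset.sum_congr rfl fun k hk => (hy k hk).1, ← Finset.mul_sum]
  have hpm : (p : ℤ) = 2 * m + 1 := by exact_mod_cast hm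
  have hpred : ((p - 1 : ℕ) : ℤ) = p - 1 := by
    rw [Nat.cast_sub hp.one_le]; simp
  rw [hpred] at hb
  generalize (catalan m : ℤ) * sumChooseSq p m = u at *
  generalize (catalan (p - 1) : ℤ) * sumChooseSq p (p - 1) = w at *
  generalize ∑ k ∈ ((Finset.range p).erase m).erase (p - 1), y k = Y at *
  have hu : ((p : ℤ) + 1) * u = 2 + 2 * p ^ 2 * a := by
    apply mul_left_cancel₀ hp0
    linear_combination 2 * ha + ((p : ℤ) * u + 2 * (m + 1) * u) * hpm
  have hw : (2 * (p : ℤ) - 1) * w = 1 + p ^ 2 * b := by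
    apply mul_left_cancel₀ hp0
    linear_combination hb
  refine ⟨u + 2 * (1 - p) * a + 4 * w - (2 * p + 1) * b + c, ?_⟩
  linear_combination (1 - (p : ℤ)) * hu - (2 * (p : ℤ) + 1) * hw + p * hc
end

section
/- Let p > 3 be a prime and let x be a p-adic integer with x ≡ -2k (mod p) for some k ∈ {1, …, ⌊(p-1)/3⌋}. Then ∑_{r=0}^{p-1} (-1)^r C(x,r)³ ≡ 0 (mod p²), where the congruence is in the ring ℤ_p of p-adic integers. -/
/-- The generalized binomial coefficient `C(x,r) = x(x-1)⋯(x-r+1)/r!`. -/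
noncomputable def gchoose {K : Type*} [Field K] (x : K) (r : ℕ) : K :=
  (∏ i ∈ Finset.range r, (x - (i : K))) / (r.factorial : K)

open Polynomial in
theorem Polynomial.sum_eval_derivative_eq_zero {p : ℕ} [Fact p.Prime] (P : (ZMod p)[X])
    (hP : P.natDegree < 2 * p - 1) : ∑ a : ZMod p, (derivative P).eval a = 0 := by
  have hp := (Fact.out : p.Prime).two_le
  simp_rw [Polynomial.derivative_eval, Polynomial.sum_def]
  rw [Finset.sum_comm]
  refine Finset.sum_eq_zero fun j hj => ?_
  have hj' : j < 2 * p - 1 := (le_natDegree_of_mem_supp j hj).trans_lt hP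
  rw [← Finset.mul_sum]
  rcases eq_or_ne j p with rfl | hjp
  · simp
  rcases Nat.lt_or_ge (j - 1) (p - 1) with h | h
  · rw [FiniteField.sum_pow_lt_card_sub_one (ZMod p) (j - 1) (by rwa [ZMod.card]), mul_zero]
  · have hmod : ∀ a : ZMod p, a ^ (j - 1) = a ^ (j - p) := fun a => by
      have h1 : j - 1 = (j - p - 1) + p := by omega
      rw [h1, pow_add, ZMod.pow_card, ← pow_succ]
      congr 1
      omega
    simp_rw [hmod]
    rw [FiniteField.sum_pow_lt_card_sub_one (ZMod p) (j - p) (by rw [ZMod.card]; omega), mul_zero]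

open Polynomial in
theorem Polynomial.dvd_sum_range_eval_derivative {p : ℕ} [Fact p.Prime] (P : ℤ[X])
    (hP : P.natDegree < 2 * p - 1) :
    (p : ℤ) ∣ ∑ r ∈ Finset.range p, (derivative P).eval (r : ℤ) := by
  have h := Polynomial.sum_eval_derivative_eq_zero (P.map (Int.castRingHom (ZMod p)))
    (natDegree_map_le.trans_lt hP)
  rw [← ZMod.intCast_zmod_eq_zero_iff_dvd, Int.cast_sum, ← h]
  refine Finset.sum_bij' (fun r _ => (r : ZMod p)) (fun a _ => a.val) ?_ ?_ ?_ ?_ ?_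
  · simp
  · simp [ZMod.val_lt]
  · intro r hr
    exact ZMod.val_cast_of_lt (Finset.mem_range.1 hr)
  · simp
  · intro r _
    simp

open Polynomial in
theorem sq_dvd_sum_prod_add_cube {p : ℕ} [Fact p.Prime] (h2 : p ≠ 2) {k : ℕ} (hk1 : 1 ≤ k)
    (hk : 3 * k < p) :
    (p : ℤ) ^ 2 ∣ ∑ r ∈ Finset.range p, (∏ i ∈ Finset.range (2 * k - 1), ((r : ℤ) + (i + 1))) ^ 3 := by
  set G : ℤ[X] := ∏ i ∈ Finset.range (2 * k - 1), (X + C ((i : ℤ) + 1)) with hG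
  have hGeval (y : ℤ) : G.eval y = ∏ i ∈ Finset.range (2 * k - 1), (y + (i + 1)) := by
    simp [hG, eval_prod]
  have hGdeg : G.natDegree ≤ 2 * k - 1 := by
    refine (natDegree_prod_le _ _).trans ?_
    simp only [natDegree_X_add_C]
    simp
  have hdeg : (G ^ 3).natDegree < 2 * p - 1 := by
    refine (natDegree_pow_le_of_le 3 hGdeg).trans_lt (by omega)
  have hrefl (y : ℤ) : G.eval (-(2 * k : ℕ) - y) = -G.eval y := by
    rw [hGeval, hGeval, ← Finset.prod_range_reflect]
    have : (-1 : ℤ) = ∏ i ∈ Finset.range (2 * k - 1), (-1 : ℤ) := by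
      rw [Finset.prod_const, Finset.card_range, Odd.neg_one_pow ⟨k - 1, by omega⟩]
    rw [neg_eq_neg_one_mul (∏ i ∈ Finset.range _, _), this, ← Finset.prod_mul_distrib]
    refine Finset.prod_congr rfl fun i hi => ?_
    have := Finset.mem_range.1 hi
    have h1 : ((2 * k - 1 - 1 - i : ℕ) : ℤ) = 2 * k - 1 - 1 - i := by omega
    rw [h1]; push_cast; ring
  have hzero (r : ℕ) (hr : p - 2 * k + 1 ≤ r) (hr' : r < p) : (p : ℤ) ∣ G.eval (r : ℤ) := by
    rw [hGeval]
    refine dvd_trans (dvd_of_eq ?_) (Finset.dvd_prod_of_mem _ (a := p - r - 1)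
      (Finset.mem_range.2 (by omega)))
    omega
  have hsplit (f : ℕ → ℤ) : ∑ r ∈ Finset.range p, f r = ∑ r ∈ Finset.range (p - 2 * k + 1), f r
      + ∑ r ∈ Finset.Ico (p - 2 * k + 1) p, f r :=
    (Finset.sum_range_add_sum_Ico f (by omega)).symm
  simp_rw [← hGeval]
  have hder := Polynomial.dvd_sum_range_eval_derivative (p := p) (G ^ 3) hdeg
  rw [hsplit] at hder ⊢
  rw [dvd_add_left] at hder ⊢
  rotate_left
  · refine Finset.dvd_sum fun r hr => ?_
    rw [Finset.mem_Ico] at hr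
    exact (pow_dvd_pow _ (by norm_num)).trans (pow_dvd_pow_of_dvd (hzero r hr.1 hr.2) 3)
  · refine Finset.dvd_sum fun r hr => ?_
    rw [Finset.mem_Ico] at hr
    rw [derivative_pow, eval_mul, eval_mul, eval_pow]
    exact ((dvd_pow (hzero r hr.1 hr.2) (by norm_num)).mul_left _).mul_right _
  set N := p - 2 * k + 1 with hN
  have hpair : ∀ r ∈ Finset.range N, (p : ℤ) ^ 2 ∣ G.eval (r : ℤ) ^ 3 +
      G.eval ((N - 1 - r : ℕ) : ℤ) ^ 3 - p * (derivative (G ^ 3)).eval (r : ℤ) := by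
    intro r hr
    have := Finset.mem_range.1 hr
    have h1 : ((N - 1 - r : ℕ) : ℤ) = -(2 * k : ℕ) - (r + -p) := by omega
    obtain ⟨c, hc⟩ := (G ^ 3).binomExpansion (r : ℤ) (-p)
    rw [eval_pow, eval_pow] at hc
    rw [h1, hrefl, Odd.neg_pow (by decide), hc]
    exact ⟨-c, by ring⟩
  have hsum := Finset.dvd_sum hpair
  rw [Finset.sum_sub_distrib, Finset.sum_add_distrib,
    Finset.sum_range_reflect (fun r => G.eval (r : ℤ) ^ 3) N, ← Finset.mul_sum,
    dvd_sub_left (by rw [sq]; exact mul_dvd_mul_left _ hder), ← two_mul] at hsum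
  refine IsCoprime.dvd_of_dvd_mul_left (IsCoprime.pow_left ?_) hsum
  exact Nat.isCoprime_iff_coprime.2 <| (Nat.coprime_primes Fact.out Nat.prime_two).2 h2

theorem sum_range_neg_one_pow_mul_choose_cube {n N : ℕ} (hn : Odd n) (hN : n < N) :
    ∑ r ∈ Finset.range N, (-1 : ℤ) ^ r * (n.choose r : ℤ) ^ 3 = 0 := by
  rw [← Finset.sum_range_add_sum_Ico _ (show n + 1 ≤ N from hN)]
  rw [Finset.sum_eq_zero (s := Finset.Ico _ _), add_zero]
  · have h := Finset.sum_range_reflect (fun r => (-1 : ℤ) ^ r * (n.choose r : ℤ) ^ 3) (n + 1)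
    have h' : ∑ r ∈ Finset.range (n + 1), (-1 : ℤ) ^ (n + 1 - 1 - r) *
        (n.choose (n + 1 - 1 - r) : ℤ) ^ 3 =
        -∑ r ∈ Finset.range (n + 1), (-1 : ℤ) ^ r * (n.choose r : ℤ) ^ 3 := by
      rw [← Finset.sum_neg_distrib]
      refine Finset.sum_congr rfl fun r hr => ?_
      have hr := Finset.mem_range_succ_iff.1 hr
      rw [Nat.add_sub_cancel, Nat.choose_symm hr]
      have hs : (-1 : ℤ) ^ (n - r) * (-1) ^ r = -1 := by
        rw [← pow_add, Nat.sub_add_cancel hr, hn.neg_one_pow]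
      have hs' : (-1 : ℤ) ^ r * (-1) ^ r = 1 := by rw [← mul_pow]; simp
      linear_combination (n.choose r : ℤ) ^ 3 * ((-1) ^ r * hs - (-1) ^ (n - r) * hs')
    linarith
  · intro r hr
    rw [Nat.choose_eq_zero_of_lt (Finset.mem_Ico.1 hr).1]
    simp

open Polynomial in
/-- The polynomial `m!³ ∑_{r < m + 1} (-1)^r C(X,r)³`, which has integer coefficients. -/
noncomputable def chooseCubeSum (m : ℕ) : ℤ[X] :=
  ∑ r ∈ Finset.range (m + 1),
    (-1) ^ r * (C ((m.factorial / r.factorial : ℕ) : ℤ) * ∏ i ∈ Finset.range r, (X - C (i : ℤ))) ^ 3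

theorem aeval_chooseCubeSum {R : Type*} [CommRing R] (m : ℕ) (y : R) (b : ℕ → R)
    (hb : ∀ r, (r.factorial : R) * b r = ∏ i ∈ Finset.range r, (y - i)) :
    Polynomial.aeval y (chooseCubeSum m) =
      (m.factorial : R) ^ 3 * ∑ r ∈ Finset.range (m + 1), (-1) ^ r * b r ^ 3 := by
  rw [chooseCubeSum, map_sum, Finset.mul_sum]
  refine Finset.sum_congr rfl fun r hr => ?_
  have h : m.factorial = m.factorial / r.factorial * r.factorial :=
    (Nat.div_mul_cancel (Nat.factorial_dvd_factorial (Finset.mem_range_succ_iff.1 hr))).symm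
  have h' : (m.factorial : R) = (m.factorial / r.factorial : ℕ) * r.factorial := by
    exact_mod_cast congrArg (Nat.cast (R := R)) h
  simp only [map_mul, map_pow, map_neg, map_one, map_prod, map_sub, Polynomial.aeval_X,
    map_natCast]
  rw [← hb, h']
  ring

theorem eval_chooseCubeSum_eq_zero {n m : ℕ} (hn : Odd n) (hm : n ≤ m) :
    (chooseCubeSum m).eval (n : ℤ) = 0 := by
  rw [← Polynomial.coe_aeval_eq_eval, aeval_chooseCubeSum m (n : ℤ) (fun r => (n.choose r : ℤ)),
    sum_range_neg_one_pow_mul_choose_cube hn (by omega), mul_zero]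
  intro r
  rw [← Nat.cast_mul, ← Nat.descFactorial_eq_factorial_mul_choose,
    ← descPochhammer_eval_eq_descFactorial ℤ n r, descPochhammer_eval_eq_prod_range]

theorem sq_dvd_eval_chooseCubeSum {p : ℕ} [Fact p.Prime] (h2 : p ≠ 2) {k : ℕ} (hk1 : 1 ≤ k)
    (hk : 3 * k < p) : (p : ℤ) ^ 2 ∣ (chooseCubeSum (p - 1)).eval (-(2 * k : ℤ)) := by
  have hp : p.Prime := Fact.out
  have hasc (a j : ℕ) : ∏ i ∈ Finset.range j, ((a : ℤ) + (i + 1)) = (a + 1).ascFactorial j := by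
    rw [Nat.ascFactorial_eq_prod_range]
    push_cast
    exact Finset.prod_congr rfl fun i _ => by ring
  rw [← Polynomial.coe_aeval_eq_eval, aeval_chooseCubeSum (p - 1) (-(2 * k : ℤ))
    (fun r => (-1) ^ r * ((r + (2 * k - 1)).choose (2 * k - 1) : ℤ))]
  · refine Dvd.dvd.mul_left ?_ _
    have h := sq_dvd_sum_prod_add_cube h2 hk1 hk
    simp_rw [hasc, Nat.ascFactorial_eq_factorial_mul_choose, Nat.cast_mul, mul_pow] at h
    rw [← Finset.mul_sum] at h
    rw [Nat.sub_add_cancel hp.one_le]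
    have hs (r : ℕ) : (-1 : ℤ) ^ r * ((-1) ^ r * ((r + (2 * k - 1)).choose (2 * k - 1) : ℤ)) ^ 3 =
        ((r + (2 * k - 1)).choose (2 * k - 1) : ℤ) ^ 3 := by
      have hs' : (-1 : ℤ) ^ r * (-1) ^ r = 1 := by rw [← mul_pow]; simp
      linear_combination ((r + (2 * k - 1)).choose (2 * k - 1) : ℤ) ^ 3 *
        ((-1 : ℤ) ^ r * (-1) ^ r + 1) * hs'
    simp_rw [hs]
    refine IsCoprime.dvd_of_dvd_mul_left (IsCoprime.pow ?_) h
    rw [Nat.isCoprime_iff_coprime, hp.coprime_iff_not_dvd, hp.dvd_factorial]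
    omega
  · intro r
    have h := hasc (2 * k - 1) r
    rw [Nat.ascFactorial_eq_factorial_mul_choose, Nat.add_comm (2 * k - 1) r] at h
    rw [← Nat.choose_symm_add, mul_left_comm, ← Nat.cast_mul, ← h,
      ← Finset.card_range r, ← Finset.prod_const, Finset.card_range, ← Finset.prod_mul_distrib]
    refine Finset.prod_congr rfl fun i _ => ?_
    push_cast [Nat.cast_sub (show 1 ≤ 2 * k by omega)]
    ring

/-- Let `p > 3` be a prime and `x ∈ ℤ_p` with `x ≡ -2k (mod p)` for some
`k ∈ {1, …, ⌊(p-1)/3⌋}`. Then `∑_{r=0}^{p-1} (-1)^r C(x,r)³ ≡ 0 (mod p²)` in `ℤ_p`. -/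
theorem sum_neg_one_pow_choose_cube (p : ℕ) [Fact p.Prime] (h3 : 3 < p) (x : ℤ_[p])
    (k : ℕ) (hk1 : 1 ≤ k) (hk2 : k ≤ (p - 1) / 3) (hcong : (p : ℤ_[p]) ∣ x + 2 * k) :
    ∃ z : ℤ_[p],
      ∑ r ∈ Finset.range p, (-1 : ℚ_[p]) ^ r * gchoose (x : ℚ_[p]) r ^ 3 =
        (p : ℚ_[p]) ^ 2 * z := by
  have hp : p.Prime := Fact.out
  have hk : 3 * k < p := by omega
  have hodd : Odd (p - 2 * k) :=
    Nat.Odd.sub_even (by omega) (hp.odd_of_ne_two (by omega)) (even_two_mul k)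
  have hzero := eval_chooseCubeSum_eq_zero (m := p - 1) hodd (by omega)
  obtain ⟨u, hu⟩ := sq_dvd_eval_chooseCubeSum (p := p) (by omega) hk1 hk
  set T := chooseCubeSum (p - 1) with hT
  obtain ⟨v, hv⟩ : (p : ℤ) ∣ T.derivative.eval (-(2 * k : ℤ)) := by
    obtain ⟨c, hc⟩ := T.binomExpansion (-(2 * k : ℤ)) p
    rw [show (-(2 * k : ℤ)) + p = (p - 2 * k : ℕ) by omega, hzero, hu] at hc
    refine ⟨-(u + c), mul_left_cancel₀ (Nat.cast_ne_zero.2 hp.ne_zero : (p : ℤ) ≠ 0) ?_⟩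
    linear_combination -hc
  obtain ⟨s, hs⟩ := hcong
  obtain ⟨w, hw⟩ : (p : ℤ_[p]) ^ 2 ∣ Polynomial.aeval x T := by
    obtain ⟨c, hc⟩ := (T.map (algebraMap ℤ ℤ_[p])).binomExpansion (-(2 * k : ℤ) : ℤ) (p * s)
    rw [Polynomial.derivative_map, Polynomial.eval_intCast_map, Polynomial.eval_intCast_map, Int.cast_id, hu, hv,
      Polynomial.eval_map_algebraMap] at hc
    have hx : ((-(2 * k : ℤ) : ℤ) : ℤ_[p]) + p * s = x := by
      push_cast
      linear_combination -hs
    rw [hx] at hc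
    refine ⟨u + v * s + c * s ^ 2, hc.trans ?_⟩
    simp only [algebraMap_int_eq, eq_intCast]
    push_cast
    ring
  have hsum := aeval_chooseCubeSum (p - 1) (x : ℚ_[p]) (gchoose (x : ℚ_[p])) fun r => by
    rw [gchoose, mul_div_cancel₀ _ (Nat.cast_ne_zero.2 r.factorial_ne_zero)]
  rw [Nat.sub_add_cancel hp.one_le, ← hT, ← PadicInt.algebraMap_apply,
    Polynomial.aeval_algebraMap_apply, hw] at hsum
  obtain ⟨d, hd⟩ : IsUnit ((p - 1).factorial : ℤ_[p]) := by
    rw [PadicInt.isUnit_iff, PadicInt.norm_natCast_eq_one_iff, hp.coprime_iff_not_dvd,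
      hp.dvd_factorial]
    have := hp.two_le
    omega
  have hd' : (((d⁻¹ : ℤ_[p]ˣ) : ℤ_[p]) : ℚ_[p]) * (p - 1).factorial = 1 := by
    have h := d.inv_mul
    rw [hd] at h
    exact_mod_cast congrArg ((↑) : ℤ_[p] → ℚ_[p]) h
  refine ⟨((d⁻¹ : ℤ_[p]ˣ) : ℤ_[p]) ^ 3 * w, ?_⟩
  simp only [PadicInt.algebraMap_apply] at hsum
  push_cast at hsum ⊢
  set e := (((d⁻¹ : ℤ_[p]ˣ) : ℤ_[p]) : ℚ_[p])
  set f := ((p - 1).factorial : ℚ_[p])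
  have h1 : (e * f) ^ 3 = 1 := by rw [hd', one_pow]
  rw [mul_left_comm, hsum, ← mul_assoc, ← mul_pow, h1, one_mul]
end

section
/- Let p > 3 be a prime. Then ∑_{k=0}^{p-1} D_k ≡ (-1)^{(p-1)/2} - p² E_{p-3} (mod p³). -/
/-- The central Delannoy number `D_n = ∑_{k=0}^n C(n,k) C(n+k,k)`. -/
def delannoy (n : ℕ) : ℤ :=
  ∑ k ∈ Finset.range (n + 1), (n.choose k : ℤ) * ((n + k).choose k : ℤ)

/-- The Euler numbers: `E_0 = 1` and `∑_{0 ≤ k ≤ n, k even} C(n,k) E_{n-k} = 0` for `n ≥ 1`. -/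
def eulerNumber : ℕ → ℤ
  | 0 => 1
  | n + 1 =>
    -∑ j ∈ (Finset.range (n + 1)).attach,
      if Even (n + 1 - j.1) then ((n + 1).choose j.1 : ℤ) * eulerNumber j.1 else 0
  decreasing_by exact Finset.mem_range.mp j.2

open Finset

/-- Unfolding of the recursion for Euler numbers as a vanishing sum. -/
theorem sum_choose_mul_eulerNumber (n : ℕ) :
    ∑ j ∈ range (n + 1), (n.choose j : ℤ) * eulerNumber j * (1 + (-1) ^ (n - j)) =
      if n = 0 then 2 else 0 := by
  cases n with
  | zero => simp [eulerNumber]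
  | succ n =>
    have h : eulerNumber (n + 1) = -∑ j ∈ range (n + 1),
        if Even (n + 1 - j) then ((n + 1).choose j : ℤ) * eulerNumber j else 0 := by
      rw [eulerNumber]
      congr 1
      exact sum_attach (range (n + 1))
        (fun j => if Even (n + 1 - j) then ((n + 1).choose j : ℤ) * eulerNumber j else 0)
    rw [sum_range_succ, h]
    have h2 : ∑ j ∈ range (n + 1),
          ((n + 1).choose j : ℤ) * eulerNumber j * (1 + (-1) ^ (n + 1 - j)) =
        2 * ∑ j ∈ range (n + 1),
          if Even (n + 1 - j) then ((n + 1).choose j : ℤ) * eulerNumber j else 0 := by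
      rw [mul_sum]
      refine sum_congr rfl fun j _ => ?_
      split_ifs with hj
      · rw [hj.neg_one_pow]; ring
      · rw [(Nat.not_even_iff_odd.mp hj).neg_one_pow]; ring
    rw [h2]
    simp
    ring

/-- The polynomial function `y ↦ ∑ C(n,j) E_j y^(n-j)`, a rescaled Euler polynomial. -/
def eulerFun {R : Type*} [CommRing R] (n : ℕ) (y : R) : R :=
  ∑ j ∈ range (n + 1), (n.choose j : R) * (eulerNumber j : R) * y ^ (n - j)

theorem eulerFun_zero {R : Type*} [CommRing R] (n : ℕ) :
    eulerFun n (0 : R) = (eulerNumber n : R) := by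
  rw [eulerFun, sum_range_succ, sum_eq_zero]
  · simp
  · intro j hj
    have : n - j ≠ 0 := by have := mem_range.mp hj; omega
    simp [this]

theorem eulerFun_add_one_add_sub_one {R : Type*} [CommRing R] (n : ℕ) (y : R) :
    eulerFun n (y + 1) + eulerFun n (y - 1) = 2 * y ^ n := by
  have key : ∀ i ∈ range (n + 1), ∑ j ∈ range (n + 1 - i),
      (n.choose j : R) * (eulerNumber j : R) * (y ^ i * ((n - j).choose i : R) *
        (1 + (-1) ^ (n - j - i))) = if i = n then 2 * y ^ n else 0 := by
    intro i hi
    have hi' : i ≤ n := Nat.lt_succ_iff.mp (mem_range.mp hi)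
    have h := congrArg (fun z : ℤ => (z : R) * ((n.choose i : R) * y ^ i))
      (sum_choose_mul_eulerNumber (n - i))
    simp only [Int.cast_sum, sum_mul] at h
    have e : n + 1 - i = n - i + 1 := by omega
    rw [e]
    calc _ = _ := sum_congr rfl fun j hj => ?_
      _ = _ := h
      _ = _ := ?_
    · have hj' : j ≤ n - i := Nat.lt_succ_iff.mp (mem_range.mp hj)
      have hc : n.choose j * (n - j).choose i = n.choose i * (n - i).choose j := by
        have h1 := Nat.choose_mul (n := n) (k := i + j) (s := i) (by omega)
        have h2 := Nat.choose_mul (n := n) (k := i + j) (s := j) (by omega)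
        have h3 : (i + j).choose i = (i + j).choose j := by
          rw [← Nat.choose_symm_add]
        simp only [Nat.add_sub_cancel_left, Nat.add_sub_cancel] at h1 h2
        rw [← h1, ← h2, h3]
      have hc' := congrArg (Nat.cast : ℕ → R) hc
      push_cast at hc' ⊢
      rw [show n - j - i = n - i - j by omega]
      linear_combination (eulerNumber j : R) * y ^ i * (1 + (-1) ^ (n - i - j)) * hc'
    · by_cases hin : i = n
      · subst hin; simp
      · have : n - i ≠ 0 := by omega
        simp [hin, this]
  have expand : eulerFun n (y + 1) + eulerFun n (y - 1) =
      ∑ j ∈ range (n + 1), ∑ i ∈ range (n + 1 - j),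
        (n.choose j : R) * (eulerNumber j : R) * (y ^ i * ((n - j).choose i : R) *
        (1 + (-1) ^ (n - j - i))) := by
    rw [eulerFun, eulerFun, ← sum_add_distrib]
    refine sum_congr rfl fun j hj => ?_
    have hj' := mem_range.mp hj
    rw [← mul_add, sub_eq_add_neg, add_pow, add_pow, ← sum_add_distrib, mul_sum,
      show n + 1 - j = n - j + 1 by omega]
    refine sum_congr rfl fun i _ => ?_
    rw [one_pow]; ring
  rw [expand]
  have swap : ∀ f : ℕ → ℕ → R, ∑ j ∈ range (n + 1), ∑ i ∈ range (n + 1 - j), f j i =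
      ∑ i ∈ range (n + 1), ∑ j ∈ range (n + 1 - i), f j i := fun f =>
    sum_comm' fun j i => by simp only [mem_range]; omega
  rw [swap, sum_congr rfl key]
  simp

theorem sum_alternating_odd_pow {R : Type*} [CommRing R] (n N : ℕ) :
    2 * ∑ k ∈ range N, (-1 : R) ^ k * (2 * (k : R) + 1) ^ n =
      eulerFun n 0 - (-1) ^ N * eulerFun n (2 * (N : R)) := by
  induction N with
  | zero => simp
  | succ N ih =>
    rw [sum_range_succ, mul_add, ih]
    have h := eulerFun_add_one_add_sub_one n (2 * (N : R) + 1)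
    rw [show 2 * (N : R) + 1 + 1 = 2 * ((N + 1 : ℕ) : R) by push_cast; ring,
      add_sub_cancel_right] at h
    linear_combination (-(-1) ^ N : R) * h

theorem sum_alternating_odd_pow_modEq {p : ℕ} (hp : Odd p) (n : ℕ) :
    2 * ∑ k ∈ range p, (-1 : ℤ) ^ k * (2 * (k : ℤ) + 1) ^ n ≡ 2 * eulerNumber n [ZMOD p] := by
  rw [← ZMod.intCast_eq_intCast_iff]
  push_cast
  rw [sum_alternating_odd_pow, hp.neg_one_pow, ZMod.natCast_self, mul_zero, eulerFun_zero]
  ring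

theorem factorial_sq_mul_choose_mul_choose (n k : ℕ) :
    (k.factorial : ℤ) ^ 2 * ((n.choose k : ℤ) * ((n + k).choose k : ℤ)) =
      ∏ j ∈ range k, ((n : ℤ) - j) * (n + 1 + j) := by
  induction k with
  | zero => simp
  | succ k ih =>
    rw [prod_range_succ, ← ih, Nat.factorial_succ]
    have h1 : (n.choose (k + 1) : ℤ) * (k + 1) = n.choose k * ((n : ℤ) - k) := by
      rcases le_or_gt k n with h | h
      · have := Nat.choose_succ_right_eq n k
        rw [← Nat.cast_sub h]; exact_mod_cast this
      · simp [Nat.choose_eq_zero_of_lt h, Nat.choose_eq_zero_of_lt (h.trans (Nat.lt_succ_self k))]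
    have h2 : ((n : ℤ) + k + 1) * (n + k).choose k = (n + (k + 1)).choose (k + 1) * (k + 1) := by
      exact_mod_cast Nat.add_one_mul_choose_eq (n + k) k
    push_cast
    linear_combination (k.factorial : ℤ) ^ 2 * ((n + (k + 1)).choose (k + 1) * (k + 1)) * h1 -
      (k.factorial : ℤ) ^ 2 * n.choose k * ((n : ℤ) - k) * h2

theorem mul_prod_sq_sub_sq (x : ℤ) (k : ℕ) :
    x * ∏ j ∈ range k, (x ^ 2 - ((j : ℤ) + 1) ^ 2) =
      (x - k) * ∏ j ∈ range k, (x - j) * (x + 1 + j) := by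
  induction k with
  | zero => simp
  | succ k ih =>
    rw [prod_range_succ, prod_range_succ, ← mul_assoc, ih]
    push_cast
    ring

theorem mul_prod_sq_sub_sq' (x : ℤ) (k : ℕ) :
    (x + 1) * ∏ j ∈ range k, ((x + 1) ^ 2 - ((j : ℤ) + 1) ^ 2) =
      (x + 1 + k) * ∏ j ∈ range k, (x - j) * (x + 1 + j) := by
  induction k with
  | zero => simp
  | succ k ih =>
    rw [prod_range_succ, prod_range_succ, ← mul_assoc, ih]
    push_cast
    ring

theorem factorial_sq_mul_sum_choose (N k : ℕ) :
    (2 * (k : ℤ) + 1) * (k.factorial : ℤ) ^ 2 *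
        ∑ n ∈ range N, (n.choose k : ℤ) * ((n + k).choose k : ℤ) =
      N * ∏ j ∈ range k, ((N : ℤ) ^ 2 - ((j : ℤ) + 1) ^ 2) := by
  induction N with
  | zero => simp
  | succ N ih =>
    rw [sum_range_succ, mul_add, ih]
    have h1 := factorial_sq_mul_choose_mul_choose N k
    have h2 := mul_prod_sq_sub_sq N k
    have h3 := mul_prod_sq_sub_sq' N k
    push_cast
    linear_combination (2 * (k : ℤ) + 1) * h1 + h2 - h3

theorem sum_delannoy_eq (N : ℕ) :
    ∑ n ∈ range N, delannoy n =
      ∑ k ∈ range N, ∑ n ∈ range N, (n.choose k : ℤ) * ((n + k).choose k : ℤ) := by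
  rw [sum_comm]
  refine sum_congr rfl fun n hn => ?_
  rw [delannoy]
  refine sum_subset (range_subset_range.mpr (mem_range.mp hn)) fun k _ hk => ?_
  rw [Nat.choose_eq_zero_of_lt (by simp at hk; omega)]
  simp

/-- Second-order expansion of `∏ (x - (j+1)²)`, with the linear coefficient identified mod `p`. -/
theorem exists_prod_sub_sq_eq {p : ℕ} [Fact p.Prime] (x : ℤ) {k : ℕ} (hk : k < p) :
    ∃ e c : ℤ, ∏ j ∈ range k, (x - ((j : ℤ) + 1) ^ 2) =
        (-1) ^ k * (k.factorial : ℤ) ^ 2 + x * e + x ^ 2 * c ∧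
      (e : ZMod p) = -(-1) ^ k * (k.factorial : ZMod p) ^ 2 *
        ∑ j ∈ range k, (((j + 1 : ℕ) : ZMod p) ^ 2)⁻¹ := by
  induction k with
  | zero => exact ⟨0, 0, by simp, by simp⟩
  | succ k ih =>
    obtain ⟨e, c, h, he⟩ := ih (by omega)
    refine ⟨-((k : ℤ) + 1) ^ 2 * e + (-1) ^ k * (k.factorial : ℤ) ^ 2,
      e + (x - ((k : ℤ) + 1) ^ 2) * c, ?_, ?_⟩
    · rw [prod_range_succ, h, Nat.factorial_succ]
      push_cast
      ring
    · have hk0 : ((k + 1 : ℕ) : ZMod p) ≠ 0 := by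
        rw [Ne, ZMod.natCast_eq_zero_iff]
        exact Nat.not_dvd_of_pos_of_lt (by omega) hk
      rw [sum_range_succ, Nat.factorial_succ]
      have hinv := mul_inv_cancel₀ (pow_ne_zero 2 hk0)
      push_cast at he hinv ⊢
      rw [he]
      linear_combination (-(-1) ^ k * (k.factorial : ZMod p) ^ 2) * hinv

theorem sum_inv_sq_eq_zero {p : ℕ} [Fact p.Prime] (h3 : 3 < p) :
    ∑ x : ZMod p, (x ^ 2)⁻¹ = 0 := by
  have hcard : 2 < Fintype.card (ZMod p) - 1 := by
    rw [ZMod.card]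
    have : p ≠ 4 := by rintro rfl; exact absurd (Fact.out : Nat.Prime 4) (by norm_num)
    have hp := (Fact.out : p.Prime)
    omega
  rw [← FiniteField.sum_pow_lt_card_sub_one (ZMod p) 2 hcard]
  simp_rw [← inv_pow]
  exact Equiv.sum_comp (Equiv.inv (ZMod p)) (fun x => x ^ 2)

theorem sum_half_inv_sq_eq_zero {p m : ℕ} [Fact p.Prime] (h3 : 3 < p) (hm : p = 2 * m + 1) :
    ∑ j ∈ range m, (((j + 1 : ℕ) : ZMod p) ^ 2)⁻¹ = 0 := by
  have h := sum_inv_sq_eq_zero (p := p) h3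
  have h1 : ∑ x : ZMod p, (x ^ 2)⁻¹ = ∑ j ∈ range p, ((j : ZMod p) ^ 2)⁻¹ := by
    symm
    refine sum_bij (fun j _ => (j : ZMod p)) (fun _ _ => mem_univ _) ?_ ?_ (fun _ _ => rfl)
    · intro a ha b hb hab
      rw [ZMod.natCast_eq_natCast_iff] at hab
      exact Nat.ModEq.eq_of_lt_of_lt hab (mem_range.mp ha) (mem_range.mp hb)
    · intro x _
      exact ⟨x.val, mem_range.mpr x.val_lt, ZMod.natCast_zmod_val x⟩
  have hr : range p = range (m + m + 1) := by rw [hm, two_mul]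
  rw [h1, hr, sum_range_succ', sum_range_add] at h
  have h2 : ∑ j ∈ range m, (((m + j + 1 : ℕ) : ZMod p) ^ 2)⁻¹ =
      ∑ j ∈ range m, (((j + 1 : ℕ) : ZMod p) ^ 2)⁻¹ := by
    rw [← sum_range_reflect]
    refine sum_congr rfl fun j hj => ?_
    have hj' := mem_range.mp hj
    have : ((m + (m - 1 - j) + 1 : ℕ) : ZMod p) = -((j + 1 : ℕ) : ZMod p) := by
      rw [eq_neg_iff_add_eq_zero, ← Nat.cast_add,
        show m + (m - 1 - j) + 1 + (j + 1) = p by omega, ZMod.natCast_self]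
    rw [this, neg_sq]
  rw [h2] at h
  have h4 : (2 : ZMod p) ≠ 0 := by
    have : ((2 : ℕ) : ZMod p) ≠ 0 := by
      rw [Ne, ZMod.natCast_eq_zero_iff]
      exact Nat.not_dvd_of_pos_of_lt (by omega) (by omega)
    exact_mod_cast this
  refine (mul_eq_zero.mp (?_ : (2 : ZMod p) * _ = 0)).resolve_left h4
  rw [two_mul]
  simpa using h

theorem modEq_of_mul_left_of_isCoprime {a b c n : ℤ} (h : IsCoprime n c)
    (hab : c * a ≡ c * b [ZMOD n]) : a ≡ b [ZMOD n] := by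
  rw [Int.modEq_iff_dvd] at hab ⊢
  rw [← mul_sub] at hab
  exact h.dvd_of_dvd_mul_left hab

theorem isCoprime_pow_of_not_dvd {p : ℕ} (hp : p.Prime) {c : ℤ} (h : ¬ (p : ℤ) ∣ c) (n : ℕ) :
    IsCoprime ((p : ℤ) ^ n) c :=
  ((Nat.prime_iff_prime_int.mp hp).coprime_iff_not_dvd.mpr h).pow_left

theorem isCoprime_pow_factorial_sq {p k : ℕ} (hp : p.Prime) (hk : k < p) (n : ℕ) :
    IsCoprime ((p : ℤ) ^ n) ((k.factorial : ℤ) ^ 2) := by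
  refine (isCoprime_pow_of_not_dvd hp (fun h => ?_) n).pow_right
  rw [Int.natCast_dvd_natCast, hp.dvd_factorial] at h
  omega

theorem mul_sum_choose_modEq {p k : ℕ} (hp : p.Prime) (hk : k < p) :
    (2 * (k : ℤ) + 1) * ∑ n ∈ range p, (n.choose k : ℤ) * ((n + k).choose k : ℤ) ≡
      p * (-1) ^ k [ZMOD (p : ℤ) ^ 3] := by
  have := Fact.mk hp
  refine modEq_of_mul_left_of_isCoprime (isCoprime_pow_factorial_sq hp hk 3) ?_
  obtain ⟨e, c, h, -⟩ := exists_prod_sub_sq_eq (p := p) ((p : ℤ) ^ 2) hk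
  have h1 := factorial_sq_mul_sum_choose p k
  rw [h] at h1
  rw [Int.modEq_iff_dvd]
  refine ⟨-(e + p ^ 2 * c), ?_⟩
  linear_combination -h1

theorem sum_choose_half_modEq {p m : ℕ} (hp : p.Prime) (h3 : 3 < p) (hm : p = 2 * m + 1) :
    ∑ n ∈ range p, (n.choose m : ℤ) * ((n + m).choose m : ℤ) ≡ (-1) ^ m [ZMOD (p : ℤ) ^ 3] := by
  have := Fact.mk hp
  have hmp : m < p := by omega
  refine modEq_of_mul_left_of_isCoprime (isCoprime_pow_factorial_sq hp hmp 3) ?_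
  obtain ⟨e, c, h, he⟩ := exists_prod_sub_sq_eq (p := p) ((p : ℤ) ^ 2) hmp
  rw [sum_half_inv_sq_eq_zero h3 hm, mul_zero, ZMod.intCast_zmod_eq_zero_iff_dvd] at he
  obtain ⟨f, rfl⟩ := he
  have h1 := factorial_sq_mul_sum_choose p m
  have hpm : 2 * (m : ℤ) + 1 = p := by rw [hm]; push_cast; ring
  rw [h, hpm, mul_assoc] at h1
  have h2 := mul_left_cancel₀ (Nat.cast_ne_zero.mpr hp.ne_zero : (p : ℤ) ≠ 0) h1
  rw [h2, Int.modEq_iff_dvd]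
  exact ⟨-(f + p * c), by ring⟩

theorem sum_choose_add_reflect_modEq {p m k : ℕ} (hp : p.Prime) (h3 : 3 < p)
    (hm : p = 2 * m + 1) (hk : k < p) :
    (∑ n ∈ range p, (n.choose k : ℤ) * ((n + k).choose k : ℤ)) +
        ∑ n ∈ range p, (n.choose (p - 1 - k) : ℤ) * ((n + (p - 1 - k)).choose (p - 1 - k) : ℤ) ≡
      -2 * p ^ 2 * ((-1) ^ k * (2 * (k : ℤ) + 1) ^ (p - 3)) +
        (if k = m then 2 * (-1) ^ m else 0) [ZMOD (p : ℤ) ^ 3] := by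
  have := Fact.mk hp
  have hpm : 2 * (m : ℤ) + 1 = p := by rw [hm]; push_cast; ring
  split_ifs with hkm
  · subst hkm
    rw [show p - 1 - k = k by omega, hpm, ← two_mul]
    refine ((sum_choose_half_modEq hp h3 hm).mul_left 2).trans ?_
    rw [Int.modEq_iff_dvd, show p - 3 = p - 4 + 1 by omega, pow_succ]
    exact ⟨-2 * (-1) ^ k * (p : ℤ) ^ (p - 4), by ring⟩
  · have ha : ¬ (p : ℤ) ∣ 2 * (k : ℤ) + 1 := by
      rintro ⟨d, hd⟩
      have hp0 : (0 : ℤ) < p := by omega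
      have hd0 : 0 < d := by nlinarith
      have hd2 : d < 2 := by nlinarith
      have : d = 1 := by omega
      subst this
      omega
    have hb : ¬ (p : ℤ) ∣ 2 * (p : ℤ) - (2 * (k : ℤ) + 1) := fun h =>
      ha ((dvd_sub_right (Dvd.intro_left _ rfl)).mp h)
    have h1 := mul_sum_choose_modEq hp hk
    have h2 := mul_sum_choose_modEq hp (show p - 1 - k < p by omega)
    have hsign : (-1 : ℤ) ^ (p - 1 - k) = (-1) ^ k := by
      rw [neg_one_pow_congr]
      rw [Nat.even_iff, Nat.even_iff]
      omega
    have hcast : 2 * ((p - 1 - k : ℕ) : ℤ) + 1 = 2 * p - (2 * k + 1) := by omega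
    rw [hsign, hcast] at h2
    have hfermat := Int.ModEq.pow_card_sub_one_eq_one hp
      ((Nat.prime_iff_prime_int.mp hp).coprime_iff_not_dvd.mpr ha).symm
    rw [show p - 1 = p - 3 + 2 by omega, pow_add] at hfermat
    refine modEq_of_mul_left_of_isCoprime
      ((isCoprime_pow_of_not_dvd hp ha 3).mul_right (isCoprime_pow_of_not_dvd hp hb 3)) ?_
    rw [Int.modEq_iff_dvd] at h1 h2 hfermat ⊢
    obtain ⟨u, hu⟩ := h1
    obtain ⟨v, hv⟩ := h2
    obtain ⟨w, hw⟩ := hfermat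
    generalize (2 * (k : ℤ) + 1) ^ (p - 3) = z at *
    generalize (-1 : ℤ) ^ k = s at *
    generalize 2 * (k : ℤ) + 1 = a at *
    refine ⟨(2 * p - a) * u + a * v - 4 * s * a * z - 2 * s * w, ?_⟩
    linear_combination (2 * (p : ℤ) - a) * hu + a * hv - 2 * (p : ℤ) ^ 2 * s * hw

/-- For a prime `p > 3`, `∑_{k=0}^{p-1} D_k ≡ (-1)^{(p-1)/2} - p² E_{p-3} (mod p³)`. -/
theorem sum_delannoy_mod_p_cubed (p : ℕ) (hp : p.Prime) (h3 : 3 < p) :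
    ∑ k ∈ Finset.range p, delannoy k ≡
      (-1) ^ ((p - 1) / 2) - (p : ℤ) ^ 2 * eulerNumber (p - 3) [ZMOD (p : ℤ) ^ 3] := by
  have hodd : Odd p := hp.odd_of_ne_two (by omega)
  obtain ⟨m, hm⟩ := id hodd
  rw [show (p - 1) / 2 = m by omega]
  have h2 : ¬ (p : ℤ) ∣ 2 := fun h => by
    have := Int.le_of_dvd (by norm_num) h
    omega
  refine modEq_of_mul_left_of_isCoprime (isCoprime_pow_of_not_dvd hp h2 3) ?_
  have hsum := Int.ModEq.sum (s := range p) fun k hk =>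
    sum_choose_add_reflect_modEq hp h3 hm (mem_range.mp hk)
  rw [sum_add_distrib, sum_add_distrib, ← mul_sum, sum_ite_eq',
    if_pos (mem_range.mpr (by omega)),
    sum_range_reflect (fun k => ∑ n ∈ range p, (n.choose k : ℤ) * ((n + k).choose k : ℤ)),
    ← two_mul, ← sum_delannoy_eq] at hsum
  refine hsum.trans ?_
  have hE := sum_alternating_odd_pow_modEq hodd (p - 3)
  rw [Int.modEq_iff_dvd] at hE ⊢
  obtain ⟨w, hw⟩ := hE
  exact ⟨-w, by linear_combination -(p : ℤ) ^ 2 * hw⟩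
end

section
/- Let p > 3 be a prime and let q_p(2) = (2^{p-1} - 1)/p be the Fermat quotient of p to base 2. Then ∑_{k=0}^{p-1} (2k+1) D_k ≡ p + 2p² q_p(2) - p³ q_p(2)² (mod p⁴). -/
open Finset in
/-- The `k`-th summand of `delannoy`, weighted by `2n+1` and summed over `n < N`. -/
lemma sum_two_mul_add_one_choose_mul_choose (N k : ℕ) :
    ∑ n ∈ range N, (2 * (n : ℤ) + 1) * ((n.choose k : ℤ) * ((n + k).choose k : ℤ)) =
      N * (N.choose (k + 1) : ℤ) * ((N + k).choose k : ℤ) := by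
  induction N with
  | zero => simp
  | succ N ih =>
    rw [sum_range_succ, ih]
    have h1 : ((N + 1 + k).choose k : ℤ) * (N + 1) = (N + k).choose k * (N + 1 + k) := by
      have h := Nat.choose_mul_succ_eq (N + k) k
      rw [show N + k + 1 - k = N + 1 by omega, show N + k + 1 = N + 1 + k by omega] at h
      exact_mod_cast h.symm
    have h2 : (N.choose (k + 1) : ℤ) * (k + 1) = N.choose k * (N - k) := by
      rcases le_or_gt k N with h | h
      · have := Nat.choose_succ_right_eq N k
        zify [h] at this
        exact this
      · simp [Nat.choose_eq_zero_of_lt h, Nat.choose_eq_zero_of_lt (Nat.lt_succ_of_lt h)]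
    have h3 : ((N + 1).choose (k + 1) : ℤ) = N.choose k + N.choose (k + 1) := by
      exact_mod_cast Nat.choose_succ_succ N k
    push_cast
    linear_combination (-((N + 1).choose (k + 1) : ℤ)) * h1 -
      ((N + k).choose k : ℤ) * h2 - ((N + k).choose k : ℤ) * (N + 1 + k) * h3

open Finset in
lemma sum_two_mul_add_one_mul_delannoy (N : ℕ) :
    ∑ n ∈ range N, (2 * (n : ℤ) + 1) * delannoy n =
      N * ∑ k ∈ range N, (N.choose (k + 1) : ℤ) * ((N + k).choose k : ℤ) := by
  have h : ∀ n ∈ range N, (2 * (n : ℤ) + 1) * delannoy n =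
      ∑ k ∈ range N, (2 * (n : ℤ) + 1) * ((n.choose k : ℤ) * ((n + k).choose k : ℤ)) := by
    intro n hn
    rw [delannoy, ← mul_sum]
    congr 1
    refine sum_subset (range_subset_range.2 (mem_range.1 hn)) fun k _ hk => ?_
    rw [Nat.choose_eq_zero_of_lt (by simpa using hk)]
    simp
  rw [sum_congr rfl h, sum_comm, mul_sum]
  refine sum_congr rfl fun k _ => ?_
  rw [sum_two_mul_add_one_choose_mul_choose, mul_assoc]

section ZModSums

open Finset

variable {p : ℕ} [Fact p.Prime]

lemma natCast_zmod_ne_zero {k : ℕ} (h0 : 0 < k) (hk : k < p) : (k : ZMod p) ≠ 0 := by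
  rw [Ne, ZMod.natCast_eq_zero_iff]
  exact Nat.not_dvd_of_pos_of_lt h0 hk

lemma choose_pred_prime_zmod {k : ℕ} (hk : k < p) :
    ((p - 1).choose k : ZMod p) = (-1) ^ k := by
  have hp : p.Prime := Fact.out
  induction k with
  | zero => simp
  | succ k ih =>
    have h1 : (p.choose (k + 1) : ZMod p) = 0 :=
      (ZMod.natCast_eq_zero_iff _ _).2 (hp.dvd_choose_self (by omega) hk)
    obtain ⟨m, rfl⟩ : ∃ m, p = m + 1 := ⟨p - 1, by have := hp.pos; omega⟩
    rw [Nat.choose_succ_succ] at h1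
    push_cast at h1
    have h2 := ih (by omega)
    simp only [Nat.add_sub_cancel] at h2 ⊢
    rw [pow_succ]
    linear_combination h1 - h2

/-- `C(p,k)/p ≡ (-1)^(k-1)/k (mod p)` for `0 < k < p`. -/
lemma exists_choose_prime_eq_mul {k : ℕ} (h0 : 0 < k) (hk : k < p) :
    ∃ c : ℤ, (p.choose k : ℤ) = p * c ∧ (c : ZMod p) = -((-1) ^ k * (k : ZMod p)⁻¹) := by
  have hp : p.Prime := Fact.out
  obtain ⟨c, hc⟩ := hp.dvd_choose_self h0.ne' hk
  refine ⟨c, by exact_mod_cast hc, ?_⟩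
  have h1 : p * (p - 1).choose (k - 1) = p.choose k * k := by
    have h := Nat.add_one_mul_choose_eq (p - 1) (k - 1)
    rwa [Nat.sub_add_cancel hp.pos, Nat.sub_add_cancel h0] at h
  have h2 : (p - 1).choose (k - 1) = c * k := by
    rw [hc, mul_assoc] at h1
    exact Nat.eq_of_mul_eq_mul_left hp.pos h1
  have h3 := choose_pred_prime_zmod (p := p) (k := k - 1) (by omega)
  rw [h2] at h3
  push_cast at h3 ⊢
  have h4 := natCast_zmod_ne_zero h0 hk
  obtain ⟨m, rfl⟩ : ∃ m, k = m + 1 := ⟨k - 1, by omega⟩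
  rw [Nat.add_sub_cancel] at h3
  rw [← neg_mul, ← div_eq_mul_inv, eq_div_iff h4, h3, pow_succ]
  ring

/-- `(C(p+k,k) - 1)/p ≡ H_k (mod p)` for `k < p`. -/
lemma exists_choose_add_eq_one_add_mul {k : ℕ} (hk : k < p) :
    ∃ d : ℤ, ((p + k).choose k : ℤ) = 1 + p * d ∧
      (d : ZMod p) = ∑ i ∈ Ico 1 (k + 1), (i : ZMod p)⁻¹ := by
  have hp : p.Prime := Fact.out
  induction k with
  | zero => exact ⟨0, by simp⟩
  | succ k ih =>
    obtain ⟨d, hd, hd'⟩ := ih (by omega)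
    have h1 : (p + k + 1 : ℤ) * (p + k).choose k = (p + (k + 1)).choose (k + 1) * (k + 1) := by
      exact_mod_cast Nat.add_one_mul_choose_eq (p + k) k
    have h2 : (p : ℤ) ∣ ((p + (k + 1)).choose (k + 1) - 1) * ((k + 1 : ℕ) : ℤ) :=
      ⟨1 + (p + k + 1) * d, by push_cast; rw [hd] at h1; linear_combination -h1⟩
    have h3 : ¬ (p : ℤ) ∣ ((k + 1 : ℕ) : ℤ) := by
      rw [Int.natCast_dvd_natCast]
      exact Nat.not_dvd_of_pos_of_lt k.succ_pos hk
    obtain ⟨e, he⟩ := ((Nat.prime_iff_prime_int.1 hp).dvd_or_dvd h2).resolve_right h3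
    refine ⟨e, by linear_combination he, ?_⟩
    have h4 : (p : ℤ) * ((k + 1) * e) = p * (1 + (p + k + 1) * d) := by
      rw [hd] at h1
      linear_combination -h1 - (k + 1 : ℤ) * he
    have h5 := mul_left_cancel₀ (by exact_mod_cast hp.ne_zero) h4
    have h6 := congrArg (Int.cast : ℤ → ZMod p) h5
    have h7 := natCast_zmod_ne_zero k.succ_pos hk
    push_cast at h6 h7
    rw [ZMod.natCast_self, zero_add] at h6
    rw [sum_Ico_succ_top (by omega), ← hd']
    push_cast
    field_simp
    linear_combination h6

lemma sum_inv_sq_zmod (h3 : 3 < p) : ∑ k ∈ Ico 1 p, ((k : ZMod p)⁻¹) ^ 2 = 0 := by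
  have hp : p.Prime := Fact.out
  have h1 : ∑ k ∈ Ico 1 p, ((k : ZMod p)⁻¹) ^ 2 = ∑ x : ZMod p, (x⁻¹) ^ 2 := by
    rw [← sum_erase univ (a := (0 : ZMod p)) (f := fun x => (x⁻¹) ^ 2) (by simp)]
    refine sum_nbij' (fun k => (k : ZMod p)) (fun x => x.val) ?_ ?_ ?_ ?_ ?_
    · intro k hk
      rw [mem_Ico] at hk
      simpa using natCast_zmod_ne_zero (p := p) hk.1 hk.2
    · intro x hx
      rw [mem_Ico]
      exact ⟨Nat.pos_of_ne_zero (by simpa [ZMod.val_eq_zero] using hx), ZMod.val_lt x⟩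
    · intro k hk
      exact ZMod.val_cast_of_lt (mem_Ico.1 hk).2
    · intro x _
      simp
    · simp
  have h2 : ∑ x : ZMod p, (x⁻¹) ^ 2 = ∑ x : ZMod p, x ^ 2 :=
    Fintype.sum_equiv (inv_involutive.toPerm _) _ _ fun _ => rfl
  rw [h1, h2]
  exact FiniteField.sum_pow_lt_card_sub_one (K := ZMod p) 2 (by rw [ZMod.card]; omega)

lemma natCast_prime_sub_inv {k : ℕ} (hk : k < p) :
    ((p - k : ℕ) : ZMod p)⁻¹ = -(k : ZMod p)⁻¹ := by
  rw [Nat.cast_sub hk.le, ZMod.natCast_self, zero_sub, inv_neg]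

lemma neg_one_pow_sub_of_odd {R : Type*} [CommRing R] {m k : ℕ} (hm : Odd m) (hk : k ≤ m) :
    (-1 : R) ^ (m - k) = -(-1) ^ k := by
  have h1 : (-1 : R) ^ (m - k) * (-1) ^ k = -1 := by
    rw [← pow_add, Nat.sub_add_cancel hk, hm.neg_one_pow]
  have h2 : ((-1 : R) ^ k) * (-1) ^ k = 1 := by rw [← mul_pow]; simp
  linear_combination (-1) ^ k * h1 - (-1 : R) ^ (m - k) * h2

/-- `4 ∑_{0<i<k<p} (-1)^k/(ik) ≡ (∑_{0<k<p} (-1)^k/k)² (mod p)`. -/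
lemma four_mul_sum_alternating_harmonic (h3 : 3 < p) :
    4 * ∑ k ∈ Ico 1 p, ∑ i ∈ Ico 1 k, (-1) ^ k * (k : ZMod p)⁻¹ * (i : ZMod p)⁻¹ =
      (∑ k ∈ Ico 1 p, (-1) ^ k * (k : ZMod p)⁻¹) ^ 2 := by
  have hp : p.Prime := Fact.out
  have hodd : Odd p := hp.odd_of_ne_two (by omega)
  set X := ∑ k ∈ Ico 1 p, ∑ i ∈ Ico 1 k, (-1) ^ k * (k : ZMod p)⁻¹ * (i : ZMod p)⁻¹ with hX
  set Y := ∑ k ∈ Ico 1 p, ∑ i ∈ Ico 1 k, (-1) ^ i * (k : ZMod p)⁻¹ * (i : ZMod p)⁻¹ with hY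
  set Z := ∑ k ∈ Ico 1 p, ∑ i ∈ Ico 1 k,
    ((-1) ^ k * (k : ZMod p)⁻¹) * ((-1) ^ i * (i : ZMod p)⁻¹) with hZ
  set W := ∑ k ∈ Ico 1 p, ∑ i ∈ Ico 1 k, (-1) ^ i * ((k - i : ℕ) : ZMod p)⁻¹ * (i : ZMod p)⁻¹
    with hW
  have hXY : Y = -X := by
    rw [hX, hY, ← sum_neg_distrib]
    simp_rw [← sum_neg_distrib]
    rw [sum_sigma', sum_sigma']
    refine sum_nbij' (fun x => ⟨p - x.2, p - x.1⟩) (fun x => ⟨p - x.2, p - x.1⟩) ?_ ?_ ?_ ?_ ?_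
    · rintro ⟨k, i⟩ h; simp only [mem_sigma, mem_Ico] at h ⊢; omega
    · rintro ⟨k, i⟩ h; simp only [mem_sigma, mem_Ico] at h ⊢; omega
    · rintro ⟨k, i⟩ h
      simp only [mem_sigma, mem_Ico] at h
      simp only [Sigma.mk.injEq, heq_eq_eq]; omega
    · rintro ⟨k, i⟩ h
      simp only [mem_sigma, mem_Ico] at h
      simp only [Sigma.mk.injEq, heq_eq_eq]; omega
    · rintro ⟨k, i⟩ h
      simp only [mem_sigma, mem_Ico] at h
      dsimp only
      rw [natCast_prime_sub_inv (by omega), natCast_prime_sub_inv (by omega),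
        neg_one_pow_sub_of_odd hodd (by omega)]
      ring
  have hXW : X = W := by
    rw [hX, hW, sum_sigma', sum_sigma']
    refine sum_nbij' (fun x => ⟨p - x.1 + x.2, p - x.1⟩) (fun x => ⟨p - x.2, x.1 - x.2⟩)
      ?_ ?_ ?_ ?_ ?_
    · rintro ⟨k, i⟩ h; simp only [mem_sigma, mem_Ico] at h ⊢; omega
    · rintro ⟨k, i⟩ h; simp only [mem_sigma, mem_Ico] at h ⊢; omega
    · rintro ⟨k, i⟩ h
      simp only [mem_sigma, mem_Ico] at h
      simp only [Sigma.mk.injEq, heq_eq_eq]; omega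
    · rintro ⟨k, i⟩ h
      simp only [mem_sigma, mem_Ico] at h
      simp only [Sigma.mk.injEq, heq_eq_eq]; omega
    · rintro ⟨k, i⟩ h
      simp only [mem_sigma, mem_Ico] at h
      dsimp only
      rw [Nat.add_sub_cancel_left, natCast_prime_sub_inv (by omega),
        neg_one_pow_sub_of_odd hodd (by omega)]
      ring
  have hWYZ : W = Y + Z := by
    rw [hW, hY, hZ, ← sum_add_distrib]
    refine sum_congr rfl fun k hk => ?_
    rw [mem_Ico] at hk
    have hrefl : ∑ i ∈ Ico 1 k, ((-1) ^ k * (k : ZMod p)⁻¹) * ((-1) ^ i * (i : ZMod p)⁻¹) =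
        ∑ i ∈ Ico 1 k, (-1) ^ i * (k : ZMod p)⁻¹ * ((k - i : ℕ) : ZMod p)⁻¹ := by
      refine sum_nbij' (fun i => k - i) (fun i => k - i) ?_ ?_ ?_ ?_ ?_
      · intro i h; simp only [mem_Ico] at h ⊢; omega
      · intro i h; simp only [mem_Ico] at h ⊢; omega
      · intro i h; simp only [mem_Ico] at h ⊢; omega
      · intro i h; simp only [mem_Ico] at h ⊢; omega
      · intro i h
        simp only [mem_Ico] at h
        have h1 : (-1 : ZMod p) ^ k = (-1) ^ (k - i) * (-1) ^ i := by
          rw [← pow_add, Nat.sub_add_cancel h.2.le]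
        have h2 : ((-1 : ZMod p) ^ i) * (-1) ^ i = 1 := by rw [← mul_pow]; simp
        rw [Nat.sub_sub_self h.2.le, h1]
        linear_combination (-1) ^ (k - i) * (k : ZMod p)⁻¹ * (i : ZMod p)⁻¹ * h2
    rw [hrefl, ← sum_add_distrib]
    refine sum_congr rfl fun i hi => ?_
    rw [mem_Ico] at hi
    have h1 := natCast_zmod_ne_zero (p := p) (k := k) (by omega) hk.2
    have h2 := natCast_zmod_ne_zero (p := p) (k := i) (by omega) (by omega)
    have h3 := natCast_zmod_ne_zero (p := p) (k := k - i) (by omega) (by omega)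
    have h4 : (k : ZMod p) = (k - i : ℕ) + i := by
      rw [← Nat.cast_add, Nat.sub_add_cancel hi.2.le]
    field_simp
    linear_combination h4
  have hsq : ∀ n : ℕ, (∑ k ∈ Ico 1 n, (-1) ^ k * (k : ZMod p)⁻¹) ^ 2 =
      2 * ∑ k ∈ Ico 1 n, ∑ i ∈ Ico 1 k,
        ((-1) ^ k * (k : ZMod p)⁻¹) * ((-1) ^ i * (i : ZMod p)⁻¹) +
      ∑ k ∈ Ico 1 n, ((k : ZMod p)⁻¹) ^ 2 := by
    intro n
    induction n with
    | zero => simp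
    | succ n ih =>
      rcases Nat.eq_zero_or_pos n with rfl | hn
      · simp
      · rw [sum_Ico_succ_top hn, sum_Ico_succ_top hn, sum_Ico_succ_top hn, ← mul_sum]
        have h2 : ((-1 : ZMod p) ^ n) * (-1) ^ n = 1 := by rw [← mul_pow]; simp
        linear_combination ih + (n : ZMod p)⁻¹ ^ 2 * h2
  rw [hsq p, sum_inv_sq_zmod h3]
  linear_combination 2 * hXW + 2 * hWYZ + 2 * hXY

end ZModSums

open Finset in
/-- Wolstenholme's theorem, as `C(2p-1,p-1) ≡ 1 (mod p³)`. -/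
lemma wolstenholme_choose {p : ℕ} (hp : p.Prime) (h3 : 3 < p) :
    (p : ℤ) ^ 3 ∣ ((p + (p - 1)).choose (p - 1) : ℤ) - 1 := by
  have : Fact p.Prime := ⟨hp⟩
  have hc : ∀ k, ∃ c : ℤ, k ∈ Ico 1 p → (p.choose k : ℤ) = p * c ∧
      (c : ZMod p) = -((-1) ^ k * (k : ZMod p)⁻¹) := by
    intro k
    by_cases hk : k ∈ Ico 1 p
    · obtain ⟨c, h⟩ := exists_choose_prime_eq_mul (p := p) (mem_Ico.1 hk).1 (mem_Ico.1 hk).2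
      exact ⟨c, fun _ => h⟩
    · exact ⟨0, fun h => absurd h hk⟩
  choose c hc using hc
  have h1 : ((2 * p).choose p : ℤ) = 2 + p ^ 2 * ∑ k ∈ Ico 1 p, c k ^ 2 := by
    have h := Nat.sum_range_choose_sq p
    rw [← h, sum_range_succ, range_eq_Ico, sum_eq_sum_Ico_succ_bot hp.pos]
    push_cast
    rw [mul_sum, sum_congr rfl fun k hk => by rw [(hc k hk).1, mul_pow]]
    simp
    ring
  have h2 : (p : ℤ) ∣ ∑ k ∈ Ico 1 p, c k ^ 2 := by
    rw [← ZMod.intCast_zmod_eq_zero_iff_dvd]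
    push_cast
    rw [← sum_inv_sq_zmod h3]
    refine sum_congr rfl fun k hk => ?_
    rw [(hc k hk).2, neg_sq, mul_pow, ← pow_mul, mul_comm k, pow_mul]
    simp
  have h4 : (2 * p).choose p = 2 * (p + (p - 1)).choose (p - 1) := by
    obtain ⟨m, rfl⟩ : ∃ m, p = m + 1 := ⟨p - 1, by omega⟩
    rw [Nat.add_sub_cancel, show 2 * (m + 1) = (m + 1 + m) + 1 by ring, Nat.choose_succ_succ,
      Nat.choose_symm_add, two_mul]
  have h5 : (p : ℤ) ^ 3 ∣ 2 * (((p + (p - 1)).choose (p - 1) : ℤ) - 1) := by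
    obtain ⟨e, he⟩ := h2
    refine ⟨e, ?_⟩
    have h4' : ((2 * p).choose p : ℤ) = 2 * (p + (p - 1)).choose (p - 1) := by exact_mod_cast h4
    rw [he] at h1
    linear_combination h1 - h4'
  refine IsCoprime.dvd_of_dvd_mul_left (IsCoprime.pow_left ?_) h5
  rw [show (2 : ℤ) = ((2 : ℕ) : ℤ) by rfl, Nat.isCoprime_iff_coprime,
    Nat.coprime_primes hp Nat.prime_two]
  omega

open Finset in
/-- For a prime `p > 3` with Fermat quotient `q = (2^{p-1} - 1)/p`,
`∑_{k=0}^{p-1} (2k+1) D_k ≡ p + 2p² q - p³ q² (mod p⁴)`. -/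
theorem sum_two_k_add_one_delannoy (p : ℕ) (hp : p.Prime) (h3 : 3 < p)
    (q : ℤ) (hq : (p : ℤ) * q = 2 ^ (p - 1) - 1) :
    ∑ k ∈ Finset.range p, (2 * (k : ℤ) + 1) * delannoy k ≡
      (p : ℤ) + 2 * (p : ℤ) ^ 2 * q - (p : ℤ) ^ 3 * q ^ 2 [ZMOD (p : ℤ) ^ 4] := by
  have : Fact p.Prime := ⟨hp⟩
  have hcd : ∀ k, ∃ c d : ℤ, k ∈ Ico 1 p → ((p.choose k : ℤ) = p * c ∧
      (c : ZMod p) = -((-1) ^ k * (k : ZMod p)⁻¹)) ∧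
      ((p + (k - 1)).choose (k - 1) : ℤ) = 1 + p * d ∧
      (d : ZMod p) = ∑ i ∈ Ico 1 k, (i : ZMod p)⁻¹ := by
    intro k
    by_cases hk : k ∈ Ico 1 p
    · rw [mem_Ico] at hk
      obtain ⟨c, h⟩ := exists_choose_prime_eq_mul (p := p) hk.1 hk.2
      obtain ⟨d, h'⟩ := exists_choose_add_eq_one_add_mul (p := p) (k := k - 1) (by omega)
      rw [Nat.sub_add_cancel hk.1] at h'
      exact ⟨c, d, fun _ => ⟨h, h'⟩⟩
    · exact ⟨0, 0, fun h => absurd h hk⟩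
  choose c d hcd using hcd
  have hc : ∑ k ∈ Ico 1 p, c k = 2 * q := by
    have h := Nat.sum_range_choose p
    rw [sum_range_succ, range_eq_Ico, sum_eq_sum_Ico_succ_bot hp.pos] at h
    zify at h
    rw [zero_add, sum_congr rfl fun k hk => (hcd k hk).1.1, ← mul_sum,
      ← Nat.sub_add_cancel hp.pos, pow_succ, Nat.sub_add_cancel hp.pos] at h
    simp only [Nat.choose_zero_right, Nat.choose_self, Nat.cast_one] at h
    refine mul_left_cancel₀ (a := (p : ℤ)) (by exact_mod_cast hp.ne_zero) ?_
    linear_combination h - 2 * hq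
  have hcdq : (p : ℤ) ∣ ∑ k ∈ Ico 1 p, c k * d k + q ^ 2 := by
    rw [← ZMod.intCast_zmod_eq_zero_iff_dvd]
    push_cast
    have h1 := four_mul_sum_alternating_harmonic (p := p) h3
    have h2 : ∑ k ∈ Ico 1 p, (-1) ^ k * (k : ZMod p)⁻¹ = -(2 * q) := by
      have h := congrArg (Int.cast : ℤ → ZMod p) hc
      push_cast at h
      rw [← h, ← sum_neg_distrib]
      exact sum_congr rfl fun k hk => by rw [(hcd k hk).1.2, neg_neg]
    have h4 : ∑ k ∈ Ico 1 p, (c k : ZMod p) * d k =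
        -∑ k ∈ Ico 1 p, ∑ i ∈ Ico 1 k, (-1) ^ k * (k : ZMod p)⁻¹ * (i : ZMod p)⁻¹ := by
      rw [← sum_neg_distrib]
      exact sum_congr rfl fun k hk => by rw [(hcd k hk).1.2, (hcd k hk).2.2, ← mul_sum, neg_mul]
    rw [h2] at h1
    have h5 : (2 : ZMod p) ≠ 0 := by
      exact_mod_cast natCast_zmod_ne_zero (p := p) two_pos (by omega)
    refine (mul_eq_zero.1 (?_ : (2 * 2 : ZMod p) * _ = 0)).resolve_left (mul_ne_zero h5 h5)
    rw [h4]
    linear_combination -h1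
  have hsum : ∑ k ∈ range p, (p.choose (k + 1) : ℤ) * ((p + k).choose k : ℤ) =
      p * (2 * q) + p ^ 2 * ∑ k ∈ Ico 1 p, c k * d k + (p + (p - 1)).choose (p - 1) := by
    have h : ∑ k ∈ range p, (p.choose (k + 1) : ℤ) * ((p + k).choose k : ℤ) =
        ∑ k ∈ Ico 1 (p + 1), (p.choose k : ℤ) * ((p + (k - 1)).choose (k - 1) : ℤ) := by
      rw [sum_Ico_eq_sum_range]
      refine sum_congr rfl fun k _ => ?_
      rw [Nat.add_sub_cancel_left, add_comm 1 k]
    rw [h, sum_Ico_succ_top hp.one_le, ← hc, mul_sum, mul_sum, ← sum_add_distrib, Nat.choose_self,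
      Nat.cast_one, one_mul]
    congr 1
    refine sum_congr rfl fun k hk => ?_
    rw [(hcd k hk).1.1, (hcd k hk).2.1]
    ring
  obtain ⟨e, he⟩ := hcdq
  obtain ⟨w, hw⟩ := wolstenholme_choose hp h3
  rw [sum_two_mul_add_one_mul_delannoy, hsum]
  refine (Int.modEq_iff_dvd.2 ⟨e + w, ?_⟩).symm
  linear_combination (p : ℤ) ^ 3 * he + p * hw
end

section
/- Let p > 3 be a prime. Then ∑_{k=0}^{(p-3)/2} H_k^{(2)}/(2k+1) ≡ -(7/4) B_{p-3} (mod p), i.e., the p-adic valuation of ∑_{k=0}^{(p-3)/2} H_k^{(2)}/(2k+1) + (7/4) B_{p-3} (a rational number whose denominator is not divisible by p) is at least 1. -/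
open Finset

/-- The rational `x` is `p`-integral and its residue modulo `p` is `a`. -/
def HasResidue (p : ℕ) [Fact p.Prime] (x : ℚ) (a : ZMod p) : Prop :=
  ∃ z : ℤ_[p], (z : ℚ_[p]) = (x : ℚ_[p]) ∧ PadicInt.toZMod z = a

namespace HasResidue

variable {p : ℕ} [Fact p.Prime] {x y : ℚ} {a b : ZMod p}

theorem unique (hx : HasResidue p x a) (hy : HasResidue p x b) : a = b := by
  obtain ⟨z, hz, rfl⟩ := hx
  obtain ⟨w, hw, rfl⟩ := hy
  rw [Subtype.ext (hz.trans hw.symm)]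

theorem add (hx : HasResidue p x a) (hy : HasResidue p y b) : HasResidue p (x + y) (a + b) := by
  obtain ⟨z, hz, rfl⟩ := hx
  obtain ⟨w, hw, rfl⟩ := hy
  exact ⟨z + w, by push_cast; rw [hz, hw], map_add _ _ _⟩

theorem mul (hx : HasResidue p x a) (hy : HasResidue p y b) : HasResidue p (x * y) (a * b) := by
  obtain ⟨z, hz, rfl⟩ := hx
  obtain ⟨w, hw, rfl⟩ := hy
  exact ⟨z * w, by push_cast; rw [hz, hw], map_mul _ _ _⟩

theorem natCast (n : ℕ) : HasResidue p n n :=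
  ⟨n, by push_cast; rfl, map_natCast _ _⟩

theorem intCast (n : ℤ) : HasResidue p n n :=
  ⟨n, by push_cast; rfl, map_intCast _ _⟩

theorem neg (hx : HasResidue p x a) : HasResidue p (-x) (-a) := by
  simpa using (intCast (-1)).mul hx

theorem sub (hx : HasResidue p x a) (hy : HasResidue p y b) : HasResidue p (x - y) (a - b) := by
  simpa [sub_eq_add_neg] using hx.add hy.neg

theorem pow (hx : HasResidue p x a) (n : ℕ) : HasResidue p (x ^ n) (a ^ n) := by
  obtain ⟨z, hz, rfl⟩ := hx
  exact ⟨z ^ n, by push_cast; rw [hz], map_pow _ _ _⟩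

theorem inv (hx : HasResidue p x a) (ha : a ≠ 0) : HasResidue p x⁻¹ a⁻¹ := by
  obtain ⟨z, hz, rfl⟩ := hx
  have hu : IsUnit z := by
    rwa [← IsLocalRing.notMem_maximalIdeal, ← PadicInt.ker_toZMod, RingHom.mem_ker]
  obtain ⟨u, rfl⟩ := hu
  refine ⟨(u⁻¹ : ℤ_[p]ˣ), ?_, ?_⟩
  · push_cast
    rw [← hz]
    refine eq_inv_of_mul_eq_one_left ?_
    rw [← PadicInt.coe_mul, Units.inv_mul, PadicInt.coe_one]
  · refine eq_inv_of_mul_eq_one_left ?_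
    rw [← map_mul, Units.inv_mul, map_one]

theorem div (hx : HasResidue p x a) (hy : HasResidue p y b) (hb : b ≠ 0) :
    HasResidue p (x / y) (a / b) := by
  simpa [div_eq_mul_inv] using hx.mul (hy.inv hb)

theorem sum {ι : Type*} {s : Finset ι} {f : ι → ℚ} {g : ι → ZMod p}
    (h : ∀ i ∈ s, HasResidue p (f i) (g i)) : HasResidue p (∑ i ∈ s, f i) (∑ i ∈ s, g i) := by
  classical
  induction s using Finset.induction_on with
  | empty => simpa using natCast (p := p) 0
  | insert i s hi ih =>
    rw [sum_insert hi, sum_insert hi]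
    exact (h i (mem_insert_self i s)).add (ih fun j hj => h j (mem_insert_of_mem hj))

theorem exists_eq_mul (hx : HasResidue p x 0) : ∃ z : ℤ_[p], (x : ℚ_[p]) = (p : ℚ_[p]) * z := by
  obtain ⟨z, hz, h⟩ := hx
  rw [← RingHom.mem_ker, PadicInt.ker_toZMod, PadicInt.maximalIdeal_eq_span_p,
    Ideal.mem_span_singleton] at h
  obtain ⟨w, rfl⟩ := h
  exact ⟨w, by rw [← hz]; push_cast; rfl⟩

end HasResidue

theorem ZMod.natCast_ne_zero_of_pos_of_lt {n p : ℕ} (h0 : 0 < n) (h : n < p) :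
    (n : ZMod p) ≠ 0 := by
  rw [Ne, ZMod.natCast_eq_zero_iff]
  exact Nat.not_dvd_of_pos_of_lt h0 h

theorem exists_hasResidue_bernoulli (p : ℕ) [Fact p.Prime] (k : ℕ) (hk : k < p - 1) :
    ∃ b, HasResidue p (bernoulli k) b := by
  induction k using Nat.strong_induction_on with
  | _ k ih =>
    choose! b hb using fun i (hi : i < k) => ih i hi (hi.trans hk)
    have h := sum_bernoulli (k + 1)
    rw [sum_range_succ] at h
    have hk' : ((k + 1 : ℕ) : ℚ) ≠ 0 := by positivity
    have hB : bernoulli k = (((if k + 1 = 1 then 1 else 0 : ℕ) : ℚ) -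
        ∑ i ∈ range k, ((k + 1).choose i : ℚ) * bernoulli i) / ((k + 1 : ℕ) : ℚ) := by
      rw [eq_div_iff hk']
      rw [Nat.choose_succ_self_right] at h
      push_cast at h ⊢
      linarith
    rw [hB]
    exact ⟨_, ((HasResidue.natCast _).sub (HasResidue.sum fun i hi =>
      (HasResidue.natCast _).mul (hb i (mem_range.1 hi)))).div (HasResidue.natCast _)
      (ZMod.natCast_ne_zero_of_pos_of_lt (by omega) (by omega))⟩

theorem ZMod.sum_range_pow_eq {p : ℕ} [Fact p.Prime] {β : ℕ → ZMod p}
    (hβ : ∀ k < p - 1, HasResidue p (bernoulli k) (β k)) {q : ℕ} (hq : q < p - 1) (N : ℕ) :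
    ∑ k ∈ range N, (k : ZMod p) ^ q =
      ∑ i ∈ range (q + 1), β i * (q + 1).choose i * (N : ZMod p) ^ (q + 1 - i) / (q + 1 : ℕ) := by
  have h1 : HasResidue p (∑ k ∈ range N, (k : ℚ) ^ q) (∑ k ∈ range N, (k : ZMod p) ^ q) :=
    HasResidue.sum fun i _ => (HasResidue.natCast i).pow q
  refine h1.unique ?_
  rw [sum_range_pow]
  refine HasResidue.sum fun i hi => ?_
  have hi' := mem_range.1 hi
  rw [← Nat.cast_succ]
  exact (((hβ i (by omega)).mul (HasResidue.natCast _)).mul ((HasResidue.natCast _).pow _)).div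
    (HasResidue.natCast _) (ZMod.natCast_ne_zero_of_pos_of_lt (by omega) (by omega))

theorem Finset.sum_range_two_mul_add_one {M : Type*} [AddCommMonoid M] (f : ℕ → M) (m : ℕ) :
    ∑ n ∈ range (2 * m + 1), f n =
      f 0 + ∑ i ∈ range m, (f (i + 1) + f (2 * m + 1 - (i + 1))) := by
  rw [sum_range_succ', two_mul, sum_range_add, sum_add_distrib, add_comm]
  congr 2
  rw [← sum_range_reflect]
  refine sum_congr rfl fun i hi => ?_
  rw [mem_range] at hi
  congr 1
  omega

theorem Finset.sum_range_two_mul_add_one_parity {M : Type*} [AddCommMonoid M] (f : ℕ → M) (m : ℕ) :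
    ∑ n ∈ range (2 * m + 1), f n =
      f 0 + ∑ i ∈ range m, (f (2 * (i + 1)) + f (2 * m + 1 - 2 * (i + 1))) := by
  have h : ∑ n ∈ range (2 * m + 1), f n =
      f 0 + (∑ i ∈ range m, f (2 * (i + 1)) + ∑ i ∈ range m, f (2 * i + 1)) := by
    induction m with
    | zero => simp
    | succ m ih =>
      rw [show 2 * (m + 1) + 1 = 2 * m + 1 + 1 + 1 by ring, sum_range_succ, sum_range_succ, ih,
        sum_range_succ, sum_range_succ, show 2 * m + 1 + 1 = 2 * (m + 1) by ring]
      abel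
  rw [h, sum_add_distrib, ← sum_range_reflect (fun i => f (2 * i + 1))]
  congr 2
  refine sum_congr rfl fun i hi => ?_
  rw [mem_range] at hi
  congr 1
  omega

theorem ZMod.sum_range_half_pow_eq_zero {p m : ℕ} [Fact p.Prime] (hm : p = 2 * m + 1) {e : ℕ}
    (he : Even e) (h0 : 0 < e) (h1 : e < p - 1) :
    ∑ i ∈ range m, ((i + 1 : ℕ) : ZMod p) ^ e = 0 := by
  have hsum : ∑ n ∈ range p, (n : ZMod p) ^ e = 0 := by
    rw [← FiniteField.sum_pow_lt_card_sub_one (ZMod p) e (by rwa [ZMod.card])]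
    refine sum_nbij' (fun n => (n : ZMod p)) ZMod.val ?_ ?_ ?_ ?_ ?_
    · simp
    · simp [ZMod.val_lt]
    · intro n hn
      exact ZMod.val_cast_of_lt (mem_range.1 hn)
    · simp
    · simp
  have hsplit := sum_range_two_mul_add_one (fun n => (n : ZMod p) ^ e) m
  rw [← hm] at hsplit
  rw [hsplit] at hsum
  have hterm : ∀ i ∈ range m, ((i + 1 : ℕ) : ZMod p) ^ e + ((p - (i + 1) : ℕ) : ZMod p) ^ e =
      2 * ((i + 1 : ℕ) : ZMod p) ^ e := by
    intro i hi
    rw [mem_range] at hi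
    rw [Nat.cast_sub (by omega), ZMod.natCast_self, zero_sub, he.neg_pow]
    ring
  rw [sum_congr rfl hterm, ← mul_sum, Nat.cast_zero, zero_pow h0.ne', zero_add] at hsum
  have h2 : (2 : ZMod p) ≠ 0 := by
    exact_mod_cast ZMod.natCast_ne_zero_of_pos_of_lt (n := 2) (p := p) (by omega) (by omega)
  exact (mul_eq_zero.1 hsum).resolve_left h2

theorem hasResidue_sum_range_pow_div {p q : ℕ} [Fact p.Prime] {β : ℕ → ZMod p}
    (hβ : ∀ k < p - 1, HasResidue p (bernoulli k) (β k)) (hq : q < p - 1) :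
    HasResidue p ((∑ k ∈ range p, (k : ℚ) ^ q) / p) (β q) := by
  have hp : (p : ℚ) ≠ 0 := Nat.cast_ne_zero.2 (Fact.out : p.Prime).ne_zero
  have hq1 : ((q + 1 : ℕ) : ZMod p) ≠ 0 :=
    ZMod.natCast_ne_zero_of_pos_of_lt (by omega) (by omega)
  have h : (∑ k ∈ range p, (k : ℚ) ^ q) / p = ∑ i ∈ range q,
      bernoulli i * ((q + 1).choose i : ℕ) * (p : ℚ) ^ (q - i) / (q + 1 : ℕ) + bernoulli q := by
    rw [sum_range_pow, sum_range_succ, add_div, sum_div]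
    congr 1
    · refine sum_congr rfl fun i hi => ?_
      rw [mem_range] at hi
      rw [show q + 1 - i = q - i + 1 by omega, pow_succ]
      push_cast
      field_simp
    · rw [Nat.choose_succ_self_right]
      push_cast
      have : (q : ℚ) + 1 ≠ 0 := by positivity
      rw [Nat.add_sub_cancel_left]
      field_simp
  have hz : β q = ∑ i ∈ range q,
      β i * ((q + 1).choose i : ℕ) * (p : ZMod p) ^ (q - i) / (q + 1 : ℕ) + β q := by
    rw [sum_eq_zero fun i hi => ?_, zero_add]
    rw [mem_range] at hi
    rw [ZMod.natCast_self, zero_pow (by omega), mul_zero, zero_div]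
  rw [h, hz]
  refine (HasResidue.sum fun i hi => ?_).add (hβ q hq)
  rw [mem_range] at hi
  exact (((hβ i (by omega)).mul (HasResidue.natCast _)).mul ((HasResidue.natCast _).pow _)).div
    (HasResidue.natCast _) hq1

/-- The reflection `a ↦ p - a` in a sum of even powers, to second order in `p`. -/
theorem exists_sum_pow_add_sub_pow_eq (p m q : ℕ) (he : Even (q + 1)) (g : ℕ → ℕ)
    (hg : ∀ i ∈ range m, g i ≤ p) :
    ∃ e : ℤ, ((∑ i ∈ range m, (g i ^ (q + 1) + (p - g i) ^ (q + 1)) : ℕ) : ℤ) =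
      2 * ∑ i ∈ range m, (g i : ℤ) ^ (q + 1) - (q + 1) * p * ∑ i ∈ range m, (g i : ℤ) ^ q +
        p ^ 2 * e := by
  have ho : Odd q := by
    rw [← Nat.not_even_iff_odd]
    exact Nat.even_add_one.1 he
  choose k hk using fun i => nonempty_subtype.1 (Nonempty.intro
    (Polynomial.powAddExpansion (-(g i : ℤ)) (p : ℤ) (q + 1)))
  refine ⟨∑ i ∈ range m, k i, ?_⟩
  push_cast
  rw [mul_sum, mul_sum, mul_sum, ← sum_sub_distrib, ← sum_add_distrib]
  refine sum_congr rfl fun i hi => ?_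
  have h := hk i
  rw [he.neg_pow, Nat.add_sub_cancel, ho.neg_pow] at h
  rw [Nat.cast_sub (hg i hi), sub_eq_neg_add, h]
  push_cast
  ring

/-- `H_{(p-1)/2}^{(3)} ≡ -2 B_{p-3} (mod p)`, with inverse cubes written as `(p - 4)`-th powers. -/
theorem ZMod.sum_range_half_pow_sub_four {p m : ℕ} [Fact p.Prime] (hm : p = 2 * m + 1)
    (h3 : 3 < p) {β : ℕ → ZMod p} (hβ : ∀ k < p - 1, HasResidue p (bernoulli k) (β k)) :
    ∑ i ∈ range m, ((i + 1 : ℕ) : ZMod p) ^ (p - 4) = -2 * β (p - 3) := by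
  obtain ⟨q, hq⟩ : ∃ q, p = q + 4 := ⟨p - 4, by omega⟩
  have he : Even (q + 1) := ⟨m - 1, by omega⟩
  have hX := hasResidue_sum_range_pow_div (q := q + 1) hβ (by omega)
  rw [show p - 4 = q by omega, show p - 3 = q + 1 by omega]
  set A : ℤ := ∑ i ∈ range m, ((i + 1 : ℕ) : ℤ) ^ (q + 1) with hA
  set C : ℤ := ∑ i ∈ range m, ((i + 1 : ℕ) : ℤ) ^ q with hC
  obtain ⟨e, h1⟩ := exists_sum_pow_add_sub_pow_eq p m q he (fun i => i + 1) (by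
    intro i hi; rw [mem_range] at hi; omega)
  obtain ⟨f, h2⟩ := exists_sum_pow_add_sub_pow_eq p m q he (fun i => 2 * (i + 1)) (by
    intro i hi; rw [mem_range] at hi; omega)
  have s1 := sum_range_two_mul_add_one (fun n => n ^ (q + 1)) m
  have s2 := sum_range_two_mul_add_one_parity (fun n => n ^ (q + 1)) m
  rw [← hm, zero_pow (by omega), zero_add] at s1 s2
  rw [← s1] at h1
  rw [← s2] at h2
  have a2 : ∑ i ∈ range m, ((2 * (i + 1) : ℕ) : ℤ) ^ (q + 1) = 2 ^ (q + 1) * A := by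
    rw [hA, mul_sum]; exact sum_congr rfl fun i _ => by rw [← mul_pow]; push_cast; rfl
  have c2 : ∑ i ∈ range m, ((2 * (i + 1) : ℕ) : ℤ) ^ q = 2 ^ q * C := by
    rw [hC, mul_sum]; exact sum_congr rfl fun i _ => by rw [← mul_pow]; push_cast; rfl
  rw [a2, c2] at h2
  rw [← hA, ← hC] at h1
  have hpq : (q : ℤ) = p - 4 := by rw [hq]; push_cast; ring
  rw [hpq] at h1 h2
  have hp : (p : ℚ) ≠ 0 := Nat.cast_ne_zero.2 (Fact.out : p.Prime).ne_zero
  have h1' : (∑ k ∈ range p, (k : ℚ) ^ (q + 1)) =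
      2 * A - (p - 4 + 1) * p * C + p ^ 2 * e := by exact_mod_cast h1
  have h2' : (∑ k ∈ range p, (k : ℚ) ^ (q + 1)) =
      2 * (2 ^ (q + 1) * A) - (p - 4 + 1) * p * (2 ^ q * C) + p ^ 2 * f := by exact_mod_cast h2
  have key : (∑ k ∈ range p, (k : ℚ) ^ (q + 1)) / p * ((1 - 2 ^ (q + 1) : ℤ) : ℚ) =
      ((3 * C * (2 ^ q - 2 ^ (q + 1)) + p * (C * (2 ^ (q + 1) - 2 ^ q) + f - 2 ^ (q + 1) * e) : ℤ)
        : ℚ) := by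
    push_cast
    field_simp
    linear_combination h2' - 2 ^ (q + 1) * h1'
  have hres := (hX.mul (HasResidue.intCast _)).unique (key ▸ HasResidue.intCast _)
  have h20 : (2 : ZMod p) ≠ 0 := by
    exact_mod_cast ZMod.natCast_ne_zero_of_pos_of_lt (n := 2) (p := p) (by omega) (by omega)
  have h30 : (3 : ZMod p) ≠ 0 := by
    exact_mod_cast ZMod.natCast_ne_zero_of_pos_of_lt (n := 3) (p := p) (by omega) (by omega)
  have hF : (2 : ZMod p) ^ q * 8 = 1 := by
    have := ZMod.pow_card_sub_one_eq_one h20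
    rw [show p - 1 = q + 3 by omega, pow_add] at this
    rw [← this]; norm_num
  have hCz : ∑ i ∈ range m, ((i + 1 : ℕ) : ZMod p) ^ q = (C : ZMod p) := by
    rw [hC]; push_cast; rfl
  rw [hCz]
  push_cast at hres
  rw [ZMod.natCast_self, zero_mul, add_zero, pow_succ] at hres
  refine mul_left_cancel₀ h30 ?_
  linear_combination 8 * hres + (2 * β (q + 1) - 3 * (C : ZMod p)) * hF

/-- `∑_{n=1}^m (1/n²) ∑_{i<n} 1/i ≡ (3/2) B_{p-3} (mod p)` for `m = (p-1)/2`. -/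
theorem ZMod.sum_range_half_harmonic_div_sq {p m : ℕ} [Fact p.Prime] (hm : p = 2 * m + 1)
    (h3 : 3 < p) {β : ℕ → ZMod p} (hβ : ∀ k < p - 1, HasResidue p (bernoulli k) (β k)) :
    2 * ∑ n ∈ range m, (∑ i ∈ range n, ((i + 1 : ℕ) : ZMod p)⁻¹) * ((n + 1 : ℕ) : ZMod p)⁻¹ ^ 2 =
      3 * β (p - 3) := by
  have hne : ∀ n < m, ((n + 1 : ℕ) : ZMod p) ≠ 0 := fun n hn =>
    ZMod.natCast_ne_zero_of_pos_of_lt (by omega) (by omega)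
  have h20 : (2 : ZMod p) ≠ 0 := by
    exact_mod_cast ZMod.natCast_ne_zero_of_pos_of_lt (n := 2) (p := p) (by omega) (by omega)
  have hcube := ZMod.sum_range_half_pow_sub_four hm h3 hβ
  obtain ⟨q, hq⟩ : ∃ q, p = q + 5 := ⟨p - 5, by omega⟩
  have hqe : Even q := ⟨m - 2, by omega⟩
  rw [show p - 4 = q + 1 by omega, show p - 3 = q + 2 by omega] at hcube
  rw [show p - 3 = q + 2 by omega]
  have hodd : ∀ k < p - 1, Odd k → 1 < k → β k = 0 := by
    intro k hk ho h1
    have h := hβ k hk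
    rw [bernoulli_eq_zero_of_odd ho h1] at h
    exact h.unique (by simpa using HasResidue.natCast (p := p) 0)
  have hβ1 : 2 * β 1 = -1 := by
    have h := (HasResidue.natCast (p := p) 2).mul (hβ 1 (by omega))
    rw [bernoulli_one, show ((2 : ℕ) : ℚ) * (-1 / 2) = ((-1 : ℤ) : ℚ) by norm_num] at h
    exact_mod_cast h.unique (HasResidue.intCast (-1))
  have hq5 : (q : ZMod p) = -5 := by
    have : ((q + 5 : ℕ) : ZMod p) = 0 := by rw [← hq, ZMod.natCast_self]
    push_cast at this
    linear_combination this
  have hharm : ∀ n < m, ∑ i ∈ range n, ((i + 1 : ℕ) : ZMod p)⁻¹ =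
      -∑ i ∈ range (q + 4), β i * (q + 4).choose i * ((n + 1 : ℕ) : ZMod p) ^ (q + 4 - i) := by
    intro n hn
    have h := ZMod.sum_range_pow_eq hβ (q := q + 3) (by omega) (n + 1)
    rw [sum_range_succ', Nat.cast_zero, zero_pow (by omega), add_zero, ← sum_div] at h
    rw [show ((q + 3 + 1 : ℕ) : ZMod p) = -1 by push_cast; rw [hq5]; ring, div_neg, div_one] at h
    rw [← h]
    refine sum_congr rfl fun i hi => ?_
    rw [mem_range] at hi
    refine inv_eq_of_mul_eq_one_left ?_
    rw [← pow_succ, show q + 3 + 1 = p - 1 by omega]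
    exact ZMod.pow_card_sub_one_eq_one (hne i (by omega))
  have hsum : ∑ n ∈ range m,
      (∑ i ∈ range n, ((i + 1 : ℕ) : ZMod p)⁻¹) * ((n + 1 : ℕ) : ZMod p)⁻¹ ^ 2 =
      -∑ i ∈ range (q + 3), β i * (q + 4).choose i *
        ∑ n ∈ range m, ((n + 1 : ℕ) : ZMod p) ^ (q + 2 - i) := by
    simp_rw [mul_sum]
    rw [sum_comm, ← sum_neg_distrib]
    refine sum_congr rfl fun n hn => ?_
    rw [mem_range] at hn
    rw [hharm n hn, sum_range_succ, hodd (q + 3) (by omega) (by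
      rw [Nat.odd_add_one, Nat.not_odd_iff_even]; exact hqe.add (by decide)) (by omega)]
    rw [zero_mul, zero_mul, add_zero, neg_mul, sum_mul]
    congr 1
    refine sum_congr rfl fun i hi => ?_
    rw [mem_range] at hi
    rw [show q + 4 - i = q + 2 - i + 2 by omega, pow_add, mul_assoc, mul_assoc, mul_assoc,
      ← mul_pow, mul_inv_cancel₀ (hne n hn), one_pow, mul_one]
    ring
  rw [hsum, sum_eq_add (a := 1) (b := q + 2) (by omega)]
  · have hc : ((q + 4).choose (q + 2) : ZMod p) = 1 := by
      refine mul_left_cancel₀ h20 ?_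
      have h := Nat.choose_symm_of_eq_add (n := q + 4) (a := q + 2) (b := 2) rfl
      rw [h]
      have h2 : 2 * (q + 4).choose 2 = (q + 4) * (q + 3) := by
        rw [Nat.choose_two_right, Nat.mul_div_cancel' (Nat.even_mul_pred_self _).two_dvd]
        rfl
      have h3 := congrArg (Nat.cast (R := ZMod p)) h2
      push_cast at h3
      rw [h3, hq5]
      ring
    rw [hc, Nat.choose_one_right, show q + 2 - 1 = q + 1 by omega, hcube, Nat.sub_self]
    simp only [pow_zero, sum_const, card_range, nsmul_eq_mul, mul_one]
    have hm' : 2 * (m : ZMod p) = -1 := by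
      have : ((2 * m + 1 : ℕ) : ZMod p) = 0 := by rw [← hm, ZMod.natCast_self]
      push_cast at this
      linear_combination this
    push_cast
    rw [hq5]
    linear_combination (-2) * β (q + 2) * hβ1 - β (q + 2) * hm'
  · intro i hi hi'
    rw [mem_range] at hi
    rcases Nat.even_or_odd i with h | h
    · rw [ZMod.sum_range_half_pow_eq_zero hm _ (by omega) (by omega), mul_zero]
      exact (Nat.even_sub (by omega)).2 (iff_of_true (hqe.add (by decide)) h)
    · have : 1 < i := by rcases h with ⟨k, rfl⟩; omega
      rw [hodd i (by omega) h this, zero_mul, zero_mul]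
  · intro h; simp at h
  · intro h; simp at h

/-- Decomposition of `∑_{j+l≤m} 1/(j² l)` into nested harmonic sums. -/
theorem sum_harmonic_sq_mul_inv_sub {K : Type*} [Field K] (m : ℕ)
    (hne : ∀ n < m, ((n + 1 : ℕ) : K) ≠ 0) :
    ∑ k ∈ range m, (∑ i ∈ range k, ((i + 1 : ℕ) : K)⁻¹ ^ 2) * ((m - k : ℕ) : K)⁻¹ =
      ∑ n ∈ range m, ((∑ i ∈ range n, ((i + 1 : ℕ) : K)⁻¹ ^ 2) * ((n + 1 : ℕ) : K)⁻¹ +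
        2 * ((∑ i ∈ range n, ((i + 1 : ℕ) : K)⁻¹) * ((n + 1 : ℕ) : K)⁻¹ ^ 2)) := by
  induction m with
  | zero => simp
  | succ m ih =>
    have hstep : ∑ k ∈ range m, ((k + 1 : ℕ) : K)⁻¹ ^ 2 * ((m - k : ℕ) : K)⁻¹ =
        (∑ i ∈ range m, ((i + 1 : ℕ) : K)⁻¹ ^ 2) * ((m + 1 : ℕ) : K)⁻¹ +
        2 * ((∑ i ∈ range m, ((i + 1 : ℕ) : K)⁻¹) * ((m + 1 : ℕ) : K)⁻¹ ^ 2) := by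
      have hrefl : ∑ k ∈ range m, ((m - k : ℕ) : K)⁻¹ = ∑ i ∈ range m, ((i + 1 : ℕ) : K)⁻¹ := by
        rw [← sum_range_reflect]
        refine sum_congr rfl fun i hi => ?_
        rw [mem_range] at hi
        congr 2
        omega
      rw [two_mul]
      nth_rewrite 2 [← hrefl]
      rw [sum_mul, sum_mul, sum_mul, ← sum_add_distrib, ← sum_add_distrib]
      refine sum_congr rfl fun k hk => ?_
      rw [mem_range] at hk
      have ha := hne k (by omega)
      have hn := hne m (by omega)
      have hb := hne (m - k - 1) (by omega)
      rw [show m - k - 1 + 1 = m - k by omega] at hb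
      have hab : ((m + 1 : ℕ) : K) = ((k + 1 : ℕ) : K) + ((m - k : ℕ) : K) := by
        rw [← Nat.cast_add]
        congr 1
        omega
      generalize ((m + 1 : ℕ) : K) = n at *
      generalize ((k + 1 : ℕ) : K) = a at *
      generalize ((m - k : ℕ) : K) = b at *
      subst hab
      field_simp
      ring
    rw [sum_range_succ', sum_range_zero, zero_mul, add_zero,
      sum_range_succ _ m, ← hstep, ← ih fun n hn => hne n (by omega), ← sum_add_distrib]
    refine sum_congr rfl fun k hk => ?_
    rw [sum_range_succ, add_mul, Nat.add_sub_add_right]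

theorem Finset.sum_mul_sum_range_eq {K : Type*} [CommSemiring K] (f g : ℕ → K) (m : ℕ) :
    (∑ i ∈ range m, f i) * ∑ i ∈ range m, g i =
      ∑ n ∈ range m, ((∑ i ∈ range n, f i) * g n + (∑ i ∈ range n, g i) * f n + f n * g n) := by
  induction m with
  | zero => simp
  | succ m ih =>
    rw [sum_range_succ _ m, sum_range_succ _ m, sum_range_succ _ m, ← ih]
    ring

theorem ZMod.sum_harmonic_sq_div_odd {p m : ℕ} [Fact p.Prime] (hm : p = 2 * m + 1)
    (h3 : 3 < p) {β : ℕ → ZMod p} (hβ : ∀ k < p - 1, HasResidue p (bernoulli k) (β k)) :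
    ∑ k ∈ range m, (∑ i ∈ range k, ((i + 1 : ℕ) : ZMod p)⁻¹ ^ 2) / ((2 * k + 1 : ℕ) : ZMod p) =
      -(7 / 4 * β (p - 3)) := by
  have hne : ∀ n < m, ((n + 1 : ℕ) : ZMod p) ≠ 0 := fun n hn =>
    ZMod.natCast_ne_zero_of_pos_of_lt (by omega) (by omega)
  have h20 : (2 : ZMod p) ≠ 0 := by
    exact_mod_cast ZMod.natCast_ne_zero_of_pos_of_lt (n := 2) (p := p) (by omega) (by omega)
  have h40 : (4 : ZMod p) ≠ 0 := by
    exact_mod_cast ZMod.natCast_ne_zero_of_pos_of_lt (n := 4) (p := p) (by omega) (by omega)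
  have hinv : ∀ n < m, ∀ j < p - 1, ((n + 1 : ℕ) : ZMod p)⁻¹ ^ j =
      ((n + 1 : ℕ) : ZMod p) ^ (p - 1 - j) := by
    intro n hn j hj
    rw [inv_pow]
    refine inv_eq_of_mul_eq_one_left ?_
    rw [← pow_add, Nat.sub_add_cancel hj.le, ZMod.pow_card_sub_one_eq_one (hne n hn)]
  have hsq : ∑ n ∈ range m, ((n + 1 : ℕ) : ZMod p)⁻¹ ^ 2 = 0 := by
    rw [← ZMod.sum_range_half_pow_eq_zero hm (e := p - 1 - 2) ⟨m - 1, by omega⟩ (by omega)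
      (by omega)]
    exact sum_congr rfl fun n hn => hinv n (mem_range.1 hn) 2 (by omega)
  have hcube : ∑ n ∈ range m, ((n + 1 : ℕ) : ZMod p)⁻¹ ^ 3 = -2 * β (p - 3) := by
    rw [← ZMod.sum_range_half_pow_sub_four hm h3 hβ]
    exact sum_congr rfl fun n hn => hinv n (mem_range.1 hn) 3 (by omega)
  have h21 := ZMod.sum_range_half_harmonic_div_sq hm h3 hβ
  have hprod := sum_mul_sum_range_eq (fun i => ((i + 1 : ℕ) : ZMod p)⁻¹ ^ 2)
    (fun i => ((i + 1 : ℕ) : ZMod p)⁻¹) m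
  simp only [← pow_succ] at hprod
  rw [hsq, zero_mul, sum_add_distrib, sum_add_distrib, hcube] at hprod
  have hU := sum_harmonic_sq_mul_inv_sub m hne
  rw [sum_add_distrib, ← mul_sum] at hU
  have hS : ∑ k ∈ range m,
      (∑ i ∈ range k, ((i + 1 : ℕ) : ZMod p)⁻¹ ^ 2) / ((2 * k + 1 : ℕ) : ZMod p) =
      -2⁻¹ * ∑ k ∈ range m,
        (∑ i ∈ range k, ((i + 1 : ℕ) : ZMod p)⁻¹ ^ 2) * ((m - k : ℕ) : ZMod p)⁻¹ := by
    rw [mul_sum]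
    refine sum_congr rfl fun k hk => ?_
    rw [mem_range] at hk
    have hk' : ((2 * k + 1 : ℕ) : ZMod p) = -2 * ((m - k : ℕ) : ZMod p) := by
      have h0 : ((2 * k + 1 + 2 * (m - k) : ℕ) : ZMod p) = 0 := by
        rw [show 2 * k + 1 + 2 * (m - k) = p by omega, ZMod.natCast_self]
      push_cast at h0 ⊢
      linear_combination h0
    rw [hk', div_eq_mul_inv, mul_inv, inv_neg]
    ring
  rw [hS, hU]
  generalize ∑ n ∈ range m,
    (∑ i ∈ range n, ((i + 1 : ℕ) : ZMod p)⁻¹ ^ 2) * ((n + 1 : ℕ) : ZMod p)⁻¹ = x at *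
  generalize ∑ n ∈ range m,
    (∑ i ∈ range n, ((i + 1 : ℕ) : ZMod p)⁻¹) * ((n + 1 : ℕ) : ZMod p)⁻¹ ^ 2 = y at *
  field_simp
  linear_combination (-2) * h21 + 4 * hprod

/-- For a prime `p > 3`,
`∑_{k=0}^{(p-3)/2} H_k^{(2)}/(2k+1) ≡ -(7/4) B_{p-3} (mod p)`, where
`H_k^{(2)} = ∑_{j=1}^k 1/j²`; i.e. the difference is `p` times a `p`-adic integer. -/
theorem sum_harmonic_sq_div_odd (p : ℕ) [Fact p.Prime] (h3 : 3 < p) :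
    ∃ z : ℤ_[p],
      ((∑ k ∈ Finset.range ((p - 3) / 2 + 1),
          (∑ j ∈ Finset.Icc 1 k, (1 : ℚ) / (j : ℚ) ^ 2) / (2 * (k : ℚ) + 1) : ℚ) : ℚ_[p]) +
        7 / 4 * (bernoulli (p - 3) : ℚ_[p]) = (p : ℚ_[p]) * z := by
  obtain ⟨m, hm⟩ := (Fact.out : p.Prime).odd_of_ne_two (by omega)
  choose! β hβ using exists_hasResidue_bernoulli p
  have hpos {n : ℕ} (h0 : 0 < n) (h : n < p) : (n : ZMod p) ≠ 0 :=
    ZMod.natCast_ne_zero_of_pos_of_lt h0 h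
  have hS : HasResidue p (∑ k ∈ range ((p - 3) / 2 + 1),
      (∑ j ∈ Icc 1 k, (1 : ℚ) / (j : ℚ) ^ 2) / (2 * (k : ℚ) + 1)) (-(7 / 4 * β (p - 3))) := by
    rw [← ZMod.sum_harmonic_sq_div_odd hm h3 hβ, show (p - 3) / 2 + 1 = m by omega]
    refine HasResidue.sum fun k hk => ?_
    rw [mem_range] at hk
    rw [show (2 * (k : ℚ) + 1) = ((2 * k + 1 : ℕ) : ℚ) by push_cast; rfl]
    refine HasResidue.div ?_ (HasResidue.natCast _) (hpos (by omega) (by omega))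
    rw [← Finset.Ico_add_one_right_eq_Icc, sum_Ico_eq_sum_range, Nat.add_sub_cancel]
    refine HasResidue.sum fun i hi => ?_
    rw [mem_range] at hi
    rw [one_div, ← inv_pow, add_comm 1 i]
    exact ((HasResidue.natCast _).inv (hpos (by omega) (by omega))).pow 2
  have h4 : ((4 : ℕ) : ZMod p) ≠ 0 :=
    hpos (by omega) (by
      have : p ≠ 4 := by rintro rfl; exact absurd (Fact.out : Nat.Prime 4) (by decide)
      omega)
  have hB : HasResidue p (7 / 4 * bernoulli (p - 3)) (7 / 4 * β (p - 3)) :=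
    HasResidue.mul (by exact_mod_cast (HasResidue.natCast 7).div (HasResidue.natCast 4) h4)
      (hβ _ (by omega))
  have h := hS.add hB
  rw [neg_add_cancel] at h
  obtain ⟨z, hz⟩ := h.exists_eq_mul
  refine ⟨z, ?_⟩
  rw [← hz]
  push_cast
  rfl
end
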